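/- Let p be an odd prime and N a prime with N ≡ 1 (mod p). Then the p-rank of the ideal class group of L = Q(ζ_p, N^{1/p}) is at least (p-1)/2. -/

import Mathlib

open NumberField Polynomial

/-- The `p`-rank of a finite abelian group `G`: the `𝔽_p`-dimension of `G ⊗ 𝔽_p`,
equivalently of `G[p]`.  Since `#G[p] = p ^ rk_p(G)`, it is the exponent of `p`
in the cardinality of the `p`-torsion subgroup. -/
noncomputable def pRank (p : ℕ) (G : Type*) [Group G] : ℕ :=
  (Nat.card {g : G // g ^ p = 1}).factorization p

theorem card_ptors_eq_index {C : Type*} [CommGroup C] [Finite C] (p : ℕ) :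
    Nat.card {g : C // g ^ p = 1} = (powMonoidHom p : C →* C).range.index := by
  have h1 : Nat.card {g : C // g ^ p = 1} = Nat.card (powMonoidHom p : C →* C).ker := by
    apply Nat.card_congr
    exact Equiv.subtypeEquivRight (fun x => by simp [MonoidHom.mem_ker])
  have h2 := Subgroup.card_mul_index (powMonoidHom p : C →* C).ker
  have h3 := Subgroup.card_mul_index (powMonoidHom p : C →* C).range
  rw [Subgroup.index_ker] at h2
  have h4 : 0 < Nat.card (powMonoidHom p : C →* C).range := Nat.card_pos
  rw [h1]
  apply Nat.eq_of_mul_eq_mul_left h4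
  rw [h3, mul_comm, h2]

theorem le_pRank_of_quotient {C : Type*} [CommGroup C] [Finite C] (p : ℕ) (hp : p.Prime)
    (H : Subgroup C) (V : Set (C ⧸ H)) (hV : ∀ v ∈ V, v ^ p = 1) (d : ℕ)
    (hd : p ^ d ≤ Nat.card V) : d ≤ pRank p C := by
  have := Fact.mk hp
  have h1 : Nat.card V ≤ Nat.card {g : C ⧸ H // g ^ p = 1} := by
    apply Nat.card_le_card_of_injective (fun v : V => ⟨v.1, hV v.1 v.2⟩)
    intro a b hab
    simpa [Subtype.ext_iff] using hab
  have h2 : Nat.card {g : C ⧸ H // g ^ p = 1} ≤ Nat.card {g : C // g ^ p = 1} := by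
    rw [card_ptors_eq_index, card_ptors_eq_index,
      ← Subgroup.index_comap_of_surjective _ (QuotientGroup.mk'_surjective H)]
    apply Subgroup.index_antitone
    rintro _ ⟨x, rfl⟩
    exact ⟨QuotientGroup.mk' H x, by simp⟩
  have h3 : IsPGroup p (powMonoidHom p : C →* C).ker := by
    intro g
    refine ⟨1, ?_⟩
    have := g.2
    rw [MonoidHom.mem_ker] at this
    ext
    simpa using this
  obtain ⟨k, hk⟩ := IsPGroup.iff_card.mp h3
  have h4 : Nat.card {g : C // g ^ p = 1} = p ^ k := by
    rw [← hk]
    apply Nat.card_congr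
    exact Equiv.subtypeEquivRight (fun x => by simp [MonoidHom.mem_ker])
  unfold pRank
  rw [h4, hp.factorization_pow, Finsupp.single_eq_same]
  exact (Nat.pow_le_pow_iff_right hp.one_lt).mp (by omega)

theorem zpow_div_aux {G : Type*} [CommGroup G] (a : G) (m n : ℤ) :
    a ^ m / a ^ n = a ^ (m - n) := by
  rw [zpow_sub, div_eq_mul_inv]

theorem comm_aux {G : Type*} [CommGroup G] {a s a' s' v w : G} (h : a / s = a' / s' * (w / v)) :
    s / s' * w = a / a' * v := by
  rw [div_eq_iff_eq_mul] at h
  subst h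
  rw [div_mul_eq_mul_div, div_mul_eq_mul_div, div_eq_iff_eq_mul]
  simp only [div_eq_mul_inv, mul_inv_rev]
  have e1 : a' * a'⁻¹ = 1 := mul_inv_cancel _
  have e2 : v * v⁻¹ = 1 := mul_inv_cancel _
  have e3 : s' * s'⁻¹ = 1 := mul_inv_cancel _
  calc s * w = s * w * (a' * a'⁻¹) * (v * v⁻¹) * (s' * s'⁻¹) := by rw [e1, e2, e3]; simp
    _ = _ := by simp only [mul_comm, mul_left_comm, mul_assoc]

theorem box_lemma {I X Q ι T : Type*} [CommGroup I] [CommGroup X] [CommGroup Q] [Fintype ι]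
    [Finite T]
    (div : X →* I) (sI : I →* I) (sX : X →* X) (hs : ∀ x, sI (div x) = div (sX x))
    (IK : Subgroup I) (hIK : ∀ b ∈ IK, sI b = b) (hfix : ∀ x, sX x = x → div x ∈ IK)
    (p : ℕ) (nrm : X →* X) (hnrm : ∀ x, nrm (sX x) = nrm x)
    (q : X → T)
    (hq : ∀ u u', div u = 1 → nrm u ^ p = 1 → div u' = 1 → nrm u' ^ p = 1 → q u = q u' →
      ∃ v, div v = 1 ∧ u = u' * (sX v / v))
    (A : ι → I) (c : ι → X) (hA : ∀ i, sI (A i) = div (c i) * A i)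
    (hc : ∀ i, nrm (c i) ^ p = 1)
    (h1 : ∀ d : ι → ℤ, (∀ i, |d i| < p) → ∏ i, nrm (c i) ^ d i = 1 → ∏ i, c i ^ d i = 1)
    (h2 : ∀ d : ι → ℤ, (∀ i, |d i| < p) → ∏ i, nrm (c i) ^ d i = 1 → ∏ i, A i ^ d i ∈ IK →
      d = 0)
    (φ : I →* Q) (hφ : ∀ x, φ x = 1 → ∃ y, ∃ b ∈ IK, x = div y * b) :
    p ^ Fintype.card ι ≤ Nat.card T *
      Nat.card (Set.range fun e : ι → Fin p => φ (∏ i, A i ^ (e i : ℕ))) := by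
  classical
  set f : (ι → Fin p) → Q := fun e => φ (∏ i, A i ^ (e i : ℕ)) with hf
  have := Fintype.ofFinite T
  have key : ∀ b ∈ Finset.univ.image f, (Finset.univ.filter fun e => f e = b).card ≤ Nat.card T := by
    intro b hb
    obtain ⟨e0, -, rfl⟩ := Finset.mem_image.mp hb
    have hex : ∀ e : ι → Fin p, f e = f e0 → ∃ y, ∃ b ∈ IK,
        ∏ i, A i ^ ((e i : ℤ) - (e0 i : ℤ)) = div y * b := by
      intro e he
      apply hφ
      simp only [hf] at he
      simp only [zpow_sub, Finset.prod_mul_distrib, map_mul, zpow_natCast, Finset.prod_inv_distrib,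
        map_inv]
      rw [he, mul_inv_cancel]
    choose! y b hbK hyb using hex
    set u : (ι → Fin p) → X := fun e => (∏ i, c i ^ ((e i : ℤ) - (e0 i : ℤ))) * (y e / sX (y e))
      with hu
    have hu1 : ∀ e, f e = f e0 → div (u e) = 1 := by
      intro e he
      have h := congrArg sI (hyb e he)
      rw [map_mul, hIK _ (hbK e he), hs, map_prod] at h
      simp only [map_zpow, hA, mul_zpow, Finset.prod_mul_distrib] at h
      rw [hyb e he, ← mul_assoc, mul_left_inj] at h
      simp only [hu, map_mul, map_prod, map_zpow, _root_.map_div]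
      rw [← h]
      rw [mul_div_assoc', div_self']
    have hu2 : ∀ e, nrm (u e) = ∏ i, nrm (c i) ^ ((e i : ℤ) - (e0 i : ℤ)) := by
      intro e
      simp only [hu, map_mul, map_prod, map_zpow, _root_.map_div, hnrm, div_self', mul_one]
    have hu3 : ∀ e, nrm (u e) ^ p = 1 := by
      intro e
      rw [hu2, ← Finset.prod_pow]
      apply Finset.prod_eq_one
      intro i _
      rw [← zpow_natCast, ← zpow_mul, mul_comm, zpow_mul, zpow_natCast, hc, one_zpow]
    rw [Nat.card_eq_fintype_card, ← Finset.card_univ]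
    apply Finset.card_le_card_of_injOn (fun e => q (u e)) (fun _ _ => Finset.mem_univ _)
    intro e he e' he' hee
    simp only [Finset.coe_filter, Finset.mem_univ, true_and, Set.mem_ofPred_eq] at he he'
    obtain ⟨v, hv, huv⟩ := hq _ _ (hu1 e he) (hu3 e) (hu1 e' he') (hu3 e') hee
    have hd : ∀ i, |(e i : ℤ) - (e' i : ℤ)| < p := by
      intro i
      have := (e i).2
      have := (e' i).2
      rw [abs_lt]
      constructor <;> omega
    have hn : ∏ i, nrm (c i) ^ ((e i : ℤ) - (e' i : ℤ)) = 1 := by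
      have h := congrArg nrm huv
      rw [hu2, map_mul nrm (u e'), hu2, _root_.map_div, hnrm, div_self', mul_one] at h
      rw [← div_eq_one, ← Finset.prod_div_distrib] at h
      rw [← h]
      apply Finset.prod_congr rfl
      intro i _
      rw [zpow_div_aux]
      congr 1; ring
    have hc1 := h1 _ hd hn
    have hc2 : ∏ i, c i ^ ((e i : ℤ) - (e0 i : ℤ)) = ∏ i, c i ^ ((e' i : ℤ) - (e0 i : ℤ)) := by
      rw [← div_eq_one, ← Finset.prod_div_distrib, ← hc1]
      apply Finset.prod_congr rfl
      intro i _
      rw [zpow_div_aux]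
      congr 1; ring
    have hw : sX (y e / y e' * v) = y e / y e' * v := by
      simp only [hu] at huv
      rw [hc2, mul_assoc, mul_right_inj] at huv
      rw [map_mul, _root_.map_div]
      exact comm_aux huv
    have hK := hfix _ hw
    have hz := h2 _ hd hn ?_
    · funext i
      have := congrFun hz i
      simp only [Pi.zero_apply] at this
      ext
      omega
    · have : ∏ i, A i ^ ((e i : ℤ) - (e' i : ℤ)) = div (y e / y e' * v) * (b e / b e') := by
        have h3 : ∏ i, A i ^ ((e i : ℤ) - (e' i : ℤ)) = (∏ i, A i ^ ((e i : ℤ) - (e0 i : ℤ))) /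
          (∏ i, A i ^ ((e' i : ℤ) - (e0 i : ℤ))) := by
          rw [← Finset.prod_div_distrib]
          apply Finset.prod_congr rfl
          intro i _
          rw [zpow_div_aux]
          congr 1; ring
        rw [h3, hyb e he, hyb e' he', map_mul, hv, mul_one, _root_.map_div, mul_div_mul_comm]
      rw [this]
      exact IK.mul_mem hK (IK.div_mem (hbK e he) (hbK e' he'))
  have h := Finset.card_le_mul_card_image (f := f) Finset.univ _ key
  rw [Finset.card_univ, Fintype.card_fun, Fintype.card_fin] at h
  refine h.trans (le_of_eq ?_)
  congr 1
  rw [← Set.toFinset_range, Set.toFinset_card, Nat.card_eq_fintype_card]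

theorem poly_ident (p : ℕ) (hp : p.Prime) : ∃ u w : ℤ[X],
    (C (p : ℤ)) = (X - 1) ^ (p - 1) * u + (∑ j ∈ Finset.range p, X ^ j) * w := by
  have := Fact.mk hp
  have : NeZero p := ⟨hp.ne_zero⟩
  have hcyc : IsCyclotomicExtension {p} ℚ (CyclotomicField p ℚ) :=
    CyclotomicField.isCyclotomicExtension p ℚ
  have hζ := IsCyclotomicExtension.zeta_spec p ℚ (CyclotomicField p ℚ)
  obtain ⟨v, hv⟩ := IsCyclotomicExtension.Rat.associated_zeta_sub_one_pow_prime p hζ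
  obtain ⟨P, hP⟩ := hζ.integralPowerBasis.exists_eq_aeval' (v : 𝓞 (CyclotomicField p ℚ))
  rw [hζ.integralPowerBasis_gen] at hP
  have h0 : aeval hζ.toInteger (C (p : ℤ) - (X - 1) ^ (p - 1) * P) = 0 := by
    rw [map_sub, map_mul, map_pow, map_sub, ← hP, aeval_X, map_one, hv]
    simp
  have h1 : cyclotomic p ℤ ∣ C (p : ℤ) - (X - 1) ^ (p - 1) * P := by
    rw [cyclotomic_eq_minpoly hζ hp.pos]
    refine minpoly.isIntegrallyClosed_dvd (hζ.isIntegral hp.pos) ?_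
    have h2 := congrArg (algebraMap (𝓞 (CyclotomicField p ℚ)) (CyclotomicField p ℚ)) h0
    rw [← aeval_algebraMap_apply, map_zero] at h2
    exact h2
  obtain ⟨w, hw⟩ := h1
  refine ⟨P, w, ?_⟩
  rw [← cyclotomic_prime, ← hw]
  ring

theorem index_delta {Λ : Type*} [AddCommGroup Λ] [Module.Free ℤ Λ] [Module.Finite ℤ Λ]
    (p : ℕ) (hp : p.Prime) (s : Module.End ℤ Λ) (hs : ∑ j ∈ Finset.range p, s ^ j = 0) (r : ℕ)
    (hr : Module.finrank ℤ Λ ≤ (p - 1) * r) :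
    Nat.card (Λ ⧸ (LinearMap.range (s - 1))) ≠ 0 ∧
    Nat.card (Λ ⧸ (LinearMap.range (s - 1))) ≤ p ^ r := by
  obtain ⟨u, w, huw⟩ := poly_ident p hp
  have h1 := congrArg (aeval s) huw
  simp only [map_add, map_mul, map_pow, map_sub, aeval_X, map_one, map_sum, hs, zero_mul,
    add_zero, aeval_C] at h1
  have hcomm : (s - 1) ^ (p - 1) * aeval s u = aeval s u * (s - 1) ^ (p - 1) := by
    have : (s - 1) ^ (p - 1) = aeval s ((X - 1 : ℤ[X]) ^ (p - 1)) := by simp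
    rw [this, ← map_mul, ← map_mul, mul_comm]
  have hp1 : p - 1 ≠ 0 := by have := hp.two_le; omega
  have hinj : Function.Injective ⇑(s - 1 : Module.End ℤ Λ) := by
    rw [← LinearMap.ker_eq_bot, LinearMap.ker_eq_bot']
    intro m hm
    have h2 := congrArg (fun f : Module.End ℤ Λ => f m) (h1.trans hcomm)
    simp only [Module.algebraMap_end_apply, Module.End.mul_apply] at h2
    obtain ⟨k, hk⟩ := Nat.exists_eq_succ_of_ne_zero hp1
    rw [hk, pow_succ, Module.End.mul_apply, hm, map_zero, map_zero] at h2
    rcases smul_eq_zero.mp h2 with h3 | h3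
    · exact absurd h3 (by exact_mod_cast hp.ne_zero)
    · exact h3
  have hdet := congrArg LinearMap.det h1
  rw [map_mul, map_pow, show (algebraMap ℤ (Module.End ℤ Λ)) (p : ℤ) = (p : ℤ) • LinearMap.id from rfl,
    LinearMap.det_smul, LinearMap.det_id, mul_one] at hdet
  have hc : (LinearMap.det (s - 1)).natAbs = Nat.card (Λ ⧸ (LinearMap.range (s - 1))) := by
    rw [← Submodule.natAbs_det_equiv _ (LinearEquiv.ofInjective (s - 1) hinj)]
    rfl
  have habs := congrArg Int.natAbs hdet
  rw [Int.natAbs_mul, Int.natAbs_pow, Int.natAbs_pow, hc, Int.natAbs_natCast] at habs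
  have hpos : 0 < p ^ Module.finrank ℤ Λ := pow_pos hp.pos _
  have hne : Nat.card (Λ ⧸ (LinearMap.range (s - 1))) ≠ 0 := by
    intro h
    rw [h, zero_pow hp1, zero_mul] at habs
    omega
  refine ⟨hne, ?_⟩
  have h5 : Nat.card (Λ ⧸ (LinearMap.range (s - 1))) ^ (p - 1) ≤ (p ^ r) ^ (p - 1) := by
    calc _ ≤ p ^ Module.finrank ℤ Λ := by
          rw [habs]
          apply Nat.le_mul_of_pos_right
          apply Nat.pos_of_ne_zero
          intro h
          rw [h, mul_zero] at habs
          omega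
      _ ≤ p ^ ((p - 1) * r) := Nat.pow_le_pow_right hp.pos hr
      _ = _ := by rw [← pow_mul, mul_comm]
  exact (Nat.pow_le_pow_iff_left hp1).mp h5

theorem unit_index {M : Type*} [CommGroup M] (σ : M →* M) (T : Subgroup M) [Finite T]
    (hT : ∀ t ∈ T, σ t ∈ T) [Module.Free ℤ (Additive (M ⧸ T))]
    [Module.Finite ℤ (Additive (M ⧸ T))] (p : ℕ) (hp : p.Prime) (r : ℕ)
    (hr : Module.finrank ℤ (Additive (M ⧸ T)) ≤ (p - 1) * r)
    (hν : ∀ m, ∏ j ∈ Finset.range p, (⇑σ)^[j] m ∈ T)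
    (hK : Nat.card {t : T // σ t = t} ≤ p) :
    (σ / MonoidHom.id M).range.index ≠ 0 ∧ (σ / MonoidHom.id M).range.index ≤ p ^ (r + 1) := by
  set δ := σ / MonoidHom.id M with hδ
  have hT' : T ≤ T.comap σ := hT
  let sq : (M ⧸ T) →* (M ⧸ T) := QuotientGroup.map T T σ hT'
  let s : Module.End ℤ (Additive (M ⧸ T)) := (MonoidHom.toAdditive sq).toIntLinearMap
  have hsj : ∀ (j : ℕ) (m : M), (s ^ j) (Additive.ofMul (QuotientGroup.mk' T m)) =
      Additive.ofMul (QuotientGroup.mk' T ((⇑σ)^[j] m)) := by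
    intro j
    induction j with
    | zero => intro m; rfl
    | succ k ih =>
      intro m
      rw [pow_succ, Module.End.mul_apply, Function.iterate_succ]
      exact ih (σ m)
  have hs : ∑ j ∈ Finset.range p, s ^ j = 0 := by
    ext x
    obtain ⟨m, hm⟩ := QuotientGroup.mk'_surjective T x.toMul
    have hx : x = Additive.ofMul (QuotientGroup.mk' T m) := by rw [hm]; rfl
    rw [hx, LinearMap.sum_apply, Finset.sum_congr rfl (fun j _ => hsj j m), ← ofMul_prod, ← map_prod,
      LinearMap.zero_apply]
    have := (QuotientGroup.eq_one_iff _).mpr (hν m)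
    rw [QuotientGroup.mk'_apply, this]; rfl
  obtain ⟨h1, h2⟩ := index_delta p hp s hs r hr
  have h3 : Nat.card (Additive (M ⧸ T) ⧸ (LinearMap.range (s - 1))) = (δ.range ⊔ T).index := by
    have e1 : Nat.card (Additive (M ⧸ T) ⧸ (LinearMap.range (s - 1))) =
      (LinearMap.range (s - 1)).toAddSubgroup.index := rfl
    have e2 : (LinearMap.range (s - 1)).toAddSubgroup.index = (sq / MonoidHom.id (M ⧸ T)).range.index := rfl
    rw [e1, e2, ← Subgroup.index_comap_of_surjective _ (QuotientGroup.mk'_surjective T)]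
    congr 1
    ext m
    rw [Subgroup.mem_comap, Subgroup.mem_sup]
    constructor
    · rintro ⟨y, hy⟩
      obtain ⟨n, rfl⟩ := QuotientGroup.mk'_surjective T y
      have h : QuotientGroup.mk' T (δ n) = QuotientGroup.mk' T m := by
        rw [← hy]; rfl
      obtain ⟨t, ht, h⟩ := (QuotientGroup.mk'_eq_mk' T).mp h
      exact ⟨δ n, ⟨n, rfl⟩, t, ht, h⟩
    · rintro ⟨_, ⟨n, rfl⟩, t, ht, rfl⟩
      refine ⟨QuotientGroup.mk' T n, ?_⟩
      rw [map_mul, (QuotientGroup.eq_one_iff _).mpr ht |> fun h => (show QuotientGroup.mk' T t = 1 from h), mul_one]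
      rfl
  have h4 : δ.range.relIndex (δ.range ⊔ T) ≠ 0 ∧ δ.range.relIndex (δ.range ⊔ T) ≤ p := by
    rw [Subgroup.relIndex_sup_left]
    have hδT : ∀ t ∈ T, δ t ∈ T := fun t ht => T.div_mem (hT t ht) ht
    let f : T →* T := (δ.comp T.subtype).codRestrict T (fun t => hδT t t.2)
    have hle : f.range ≤ δ.range.subgroupOf T := by
      rintro _ ⟨t, rfl⟩
      exact ⟨t, rfl⟩
    have hk : f.range.index = Nat.card f.ker := by
      have a1 := f.ker.card_mul_index
      have a2 := f.range.card_mul_index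
      rw [Subgroup.index_ker] at a1
      have : Nat.card f.range ≠ 0 := Nat.card_pos.ne'
      apply Nat.eq_of_mul_eq_mul_left (Nat.pos_of_ne_zero this)
      rw [a2, ← a1, mul_comm]
    have hk2 : Nat.card f.ker ≤ p := by
      refine le_trans (Nat.card_le_card_of_injective
        (fun x : f.ker => (⟨x.1, ?_⟩ : {t : T // σ t = t})) ?_) hK
      · have := congrArg Subtype.val (MonoidHom.mem_ker.mp x.2)
        exact div_eq_one.mp this
      · intro x y h
        exact Subtype.ext (congrArg (fun z : {t : T // σ t = t} => z.1) h)
    have h0 : f.range.index ≠ 0 := by rw [hk]; exact Nat.card_pos.ne'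
    have hd : (δ.range.subgroupOf T).index ∣ f.range.index := Subgroup.index_dvd_of_le hle
    refine ⟨fun h => h0 (by rw [Subgroup.relIndex] at h; rw [h] at hd; exact zero_dvd_iff.mp hd), ?_⟩
    exact (Nat.le_of_dvd (Nat.pos_of_ne_zero h0) hd).trans (hk ▸ hk2)
  rw [h3] at h1 h2
  rw [← Subgroup.relIndex_mul_index (le_sup_left : δ.range ≤ δ.range ⊔ T)]
  refine ⟨mul_ne_zero h4.1 h1, ?_⟩
  rw [pow_succ, mul_comm]
  exact Nat.mul_le_mul h2 h4.2

/-- the action of a `K`-automorphism on the units -/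
noncomputable def actE {K L : Type} [Field K] [Field L] [Algebra K L] (σ : L ≃ₐ[K] L) :
    (𝓞 L)ˣ →* (𝓞 L)ˣ :=
  Units.map (RingOfIntegers.mapRingHom ((σ : L ≃+* L) : L →+* L) : 𝓞 L →* 𝓞 L)

theorem actE_coe {K L : Type} [Field K] [Field L] [Algebra K L] (σ : L ≃ₐ[K] L) (u : (𝓞 L)ˣ) :
    ((actE σ u : 𝓞 L) : L) = σ (u : 𝓞 L) := rfl

theorem unitE_ext {L : Type} [Field L] {u v : (𝓞 L)ˣ} (h : ((u : 𝓞 L) : L) = (v : 𝓞 L)) : u = v :=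
  Units.ext (RingOfIntegers.ext h)

theorem actE_iter {K L : Type} [Field K] [Field L] [Algebra K L] (σ : L ≃ₐ[K] L) (j : ℕ)
    (u : (𝓞 L)ˣ) : (⇑(actE σ))^[j] u = actE (σ ^ j) u := by
  induction j generalizing u with
  | zero => exact unitE_ext rfl
  | succ k ih =>
    rw [Function.iterate_succ_apply, ih]
    apply unitE_ext
    rw [actE_coe, actE_coe, actE_coe, pow_succ, AlgEquiv.mul_apply]

theorem rank_cyc (p : ℕ) (hp : p.Prime) (hpodd : Odd p) {K L : Type} [Field K] [Field L]
    [NumberField K] [NumberField L] [Algebra K L] [IsCyclotomicExtension {p} ℚ K]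
    (hdeg : Module.finrank K L = p) :
    Units.rank L ≤ (p - 1) * ((p - 1) / 2) + Units.rank K ∧ True := by
  have := Fact.mk hp
  have : NeZero p := ⟨hp.ne_zero⟩
  have hp2 : 2 < p := by
    rcases hp.eq_two_or_odd' with h | h
    · subst h; exact absurd hpodd (by decide)
    · have := hp.two_le
      rcases Nat.lt_or_ge 2 p with h | h
      · exact h
      · have : p = 2 := by omega
        subst this; exact absurd hpodd (by decide)
  have hK : IsTotallyComplex K := IsCyclotomicExtension.Rat.isTotallyComplex K hp2
  have hL : IsTotallyComplex L := isTotallyComplex_of_algebra K L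
  have h1 := IsTotallyComplex.finrank K
  have h2 := IsTotallyComplex.finrank L
  have h3 : Module.finrank ℚ K = p - 1 := by
    rw [IsCyclotomicExtension.finrank (n := p) K (cyclotomic.irreducible_rat hp.pos), Nat.totient_prime hp]
  have h4 := Module.finrank_mul_finrank ℚ K L
  rw [hdeg, h3] at h4
  have h5 := InfinitePlace.card_eq_nrRealPlaces_add_nrComplexPlaces (K := K)
  have h6 := InfinitePlace.card_eq_nrRealPlaces_add_nrComplexPlaces (K := L)
  rw [IsTotallyComplex.nrRealPlaces_eq_zero] at h5 h6
  rw [Units.rank, Units.rank, h5, h6]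
  obtain ⟨k, hk⟩ := hpodd
  rw [h3] at h1
  rw [← h4] at h2
  have hk' : p - 1 = 2 * k := by omega
  rw [hk'] at h1 h2 ⊢
  rw [hk] at h2
  have e1 : InfinitePlace.nrComplexPlaces K = k := by omega
  have e2 : InfinitePlace.nrComplexPlaces L = k * (2 * k + 1) := by
    have : 2 * InfinitePlace.nrComplexPlaces L = 2 * (k * (2 * k + 1)) := by rw [← h2]; ring
    omega
  rw [e1, e2]
  have : 2 * k / 2 = k := by omega
  rw [this]
  have hk0 : 0 < k := by omega
  refine ⟨?_, trivial⟩
  have : k * (2 * k + 1) = 2 * k * k + k := by ring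
  omega

theorem kerrank {Λ Λ' : Type*} [AddCommGroup Λ] [AddCommGroup Λ'] [Module.Free ℤ Λ] [Module.Finite ℤ Λ]
    [Module.Free ℤ Λ'] [Module.Finite ℤ Λ']
    (ν : Λ →ₗ[ℤ] Λ) (g : Λ' →ₗ[ℤ] Λ) (hg : Function.Injective g)
    (p : ℕ) (hp : p ≠ 0) (hνg : ∀ x, ν (g x) = (p : ℤ) • g x) :
    Module.finrank ℤ (LinearMap.ker ν) + Module.finrank ℤ Λ' ≤ Module.finrank ℤ Λ := by
  have h1 := Submodule.finrank_quotient_add_finrank (LinearMap.ker ν)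
  rw [LinearEquiv.finrank_eq ν.quotKerEquivRange] at h1
  let f : Λ' →ₗ[ℤ] LinearMap.range ν := LinearMap.codRestrict _ ((p : ℤ) • g) (fun x => ⟨g x, hνg x⟩)
  have h2 : Function.Injective f := by
    intro x y h
    have h := congrArg Subtype.val h
    have h : (p : ℤ) • g x = (p : ℤ) • g y := h
    exact hg (smul_right_injective Λ (by exact_mod_cast hp : (p : ℤ) ≠ 0) h)
  have := LinearMap.finrank_le_finrank_of_injective h2
  omega

theorem isOfFinOrder_iff_of_inj_aux {G H : Type*} [CommGroup G] [CommGroup H] (f : G →* H)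
    (hf : Function.Injective f) (u : G) : IsOfFinOrder (f u) ↔ IsOfFinOrder u := by
  rw [isOfFinOrder_iff_pow_eq_one, isOfFinOrder_iff_pow_eq_one]
  refine exists_congr fun n => and_congr_right fun _ => ?_
  rw [← map_pow, map_eq_one_iff f hf]

theorem unit_core (p : ℕ) (hp : p.Prime) (r : ℕ) {EK E : Type} [CommGroup EK] [CommGroup E]
    (tK : Subgroup EK) (tE : Subgroup E) (htK : ∀ x, x ∈ tK ↔ IsOfFinOrder x)
    (htE : ∀ x, x ∈ tE ↔ IsOfFinOrder x) [Finite tE]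
    [Module.Free ℤ (Additive (EK ⧸ tK))] [Module.Finite ℤ (Additive (EK ⧸ tK))]
    [Module.Free ℤ (Additive (E ⧸ tE))] [Module.Finite ℤ (Additive (E ⧸ tE))]
    (hr : Module.finrank ℤ (Additive (E ⧸ tE)) ≤ (p - 1) * r + Module.finrank ℤ (Additive (EK ⧸ tK)))
    (s νE : E →* E) (hνE : ∀ u, νE u = ∏ j ∈ Finset.range p, (⇑s)^[j] u) (hsp : ∀ u, (⇑s)^[p] u = u)
    (eK : EK →* E) (heKinj : Function.Injective eK) (heKs : ∀ x, s (eK x) = eK x)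
    (B : Type) [Finite B] (hB : Nat.card B ≤ p) (b : {t : E // s t = t ∧ (t ^ p) ^ p = 1} → B)
    (hb : Function.Injective b) :
    ∃ (T : Type) (_ : Finite T) (q : E → T), Nat.card T ≤ p ^ (r + 1) ∧
      ∀ u u' : E, (νE u) ^ p = 1 → (νE u') ^ p = 1 → q u = q u' → ∃ v : E, u = u' * (s v / v) := by
  have hcomm : ∀ u, νE (s u) = νE u := by
    intro u
    rw [hνE, hνE]
    have : ∀ j, (⇑s)^[j] (s u) = (⇑s)^[j + 1] u := fun j => by rw [Function.iterate_succ_apply]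
    rw [Finset.prod_congr rfl (fun j _ => this j)]
    have h1 := Finset.prod_range_succ (fun j => (⇑s)^[j] u) p
    have h2 := Finset.prod_range_succ' (fun j => (⇑s)^[j] u) p
    rw [h1, hsp] at h2
    exact (mul_right_cancel h2).symm
  let M : Subgroup E := ((powMonoidHom p).comp νE).ker
  have hM : ∀ u, u ∈ M ↔ νE u ^ p = 1 := fun u => Iff.rfl
  let σM : M →* M := (s.comp M.subtype).codRestrict M (fun u => by
    rw [hM, MonoidHom.comp_apply, hcomm]; exact u.2)
  let T : Subgroup M := tE.subgroupOf M
  have hTfin : Finite T := by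
    apply Finite.of_injective (fun x : T => (⟨x.1.1, x.2⟩ : tE))
    intro x y h
    have := congrArg (fun z : tE => z.1) h
    exact Subtype.ext (Subtype.ext this)
  have hhom : ∀ (f : E →* E) t, t ∈ tE → f t ∈ tE := by
    intro f t ht
    rw [htE] at ht ⊢
    exact MonoidHom.isOfFinOrder f ht
  have hhomK : ∀ t, t ∈ tK → eK t ∈ tE := by
    intro t ht
    rw [htK] at ht
    rw [htE]
    exact MonoidHom.isOfFinOrder eK ht
  let ν : Additive (E ⧸ tE) →ₗ[ℤ] Additive (E ⧸ tE) := (MonoidHom.toAdditive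
    (QuotientGroup.map tE tE νE (hhom νE))).toIntLinearMap
  let g : Additive (EK ⧸ tK) →ₗ[ℤ] Additive (E ⧸ tE) := (MonoidHom.toAdditive
    (QuotientGroup.map tK tE eK hhomK)).toIntLinearMap
  have hginj : Function.Injective g := by
    rw [injective_iff_map_eq_zero]
    intro x hx
    obtain ⟨u, hu⟩ := QuotientGroup.mk'_surjective tK x.toMul
    have hxu : x = Additive.ofMul (QuotientGroup.mk' _ u) := by rw [hu]; rfl
    subst hxu
    have h1 : (QuotientGroup.mk (eK u) : E ⧸ tE) = 1 := hx
    rw [QuotientGroup.eq_one_iff, htE] at h1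
    have h2 : u ∈ tK := by
      rw [htK]; exact (isOfFinOrder_iff_of_inj_aux eK heKinj u).mp h1
    exact (QuotientGroup.eq_one_iff u).mpr h2
  have hνg : ∀ x, ν (g x) = (p : ℤ) • g x := by
    intro x
    obtain ⟨u, hu⟩ := QuotientGroup.mk'_surjective tK x.toMul
    have hxu : x = Additive.ofMul (QuotientGroup.mk' _ u) := by rw [hu]; rfl
    subst hxu
    have h1 : νE (eK u) = eK u ^ p := by
      rw [hνE, Finset.prod_congr rfl (fun j _ => Function.iterate_fixed (heKs u) j),
        Finset.prod_const, Finset.card_range]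
    rw [natCast_zsmul]
    change (QuotientGroup.mk (νE (eK u)) : E ⧸ tE) = (QuotientGroup.mk (eK u)) ^ p
    rw [h1]; rfl
  have hker := kerrank ν g hginj p hp.ne_zero hνg
  let i : Additive (M ⧸ T) →ₗ[ℤ] LinearMap.ker ν := LinearMap.codRestrict _
    (MonoidHom.toAdditive (QuotientGroup.map T tE M.subtype (fun t ht => ht))).toIntLinearMap
    (fun x => by
      obtain ⟨u, hu⟩ := QuotientGroup.mk'_surjective T x.toMul
      have hxu : x = Additive.ofMul (QuotientGroup.mk' _ u) := by rw [hu]; rfl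
      subst hxu
      rw [LinearMap.mem_ker]
      change (QuotientGroup.mk (νE u) : E ⧸ tE) = 1
      rw [QuotientGroup.eq_one_iff, htE]
      exact isOfFinOrder_iff_pow_eq_one.mpr ⟨p, hp.pos, u.2⟩)
  have hiinj : Function.Injective i := by
    rw [injective_iff_map_eq_zero]
    intro x hx
    obtain ⟨u, hu⟩ := QuotientGroup.mk'_surjective T x.toMul
    have hxu : x = Additive.ofMul (QuotientGroup.mk' _ u) := by rw [hu]; rfl
    subst hxu
    have h1 : (QuotientGroup.mk (u : E) : E ⧸ tE) = 1 := congrArg Subtype.val hx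
    rw [QuotientGroup.eq_one_iff] at h1
    have h2 : u ∈ T := h1
    exact (QuotientGroup.eq_one_iff u).mpr h2
  have : Module.Finite ℤ (Additive (M ⧸ T)) := Module.Finite.of_injective i hiinj
  have : Module.Free ℤ (Additive (M ⧸ T)) := Module.Free.of_equiv (LinearEquiv.ofInjective i hiinj).symm
  have hrank : Module.finrank ℤ (Additive (M ⧸ T)) ≤ (p - 1) * r := by
    have a := LinearMap.finrank_le_finrank_of_injective hiinj
    omega
  have hMiter : ∀ (j : ℕ) (m : M), (((⇑σM)^[j] m : M) : E) = (⇑s)^[j] m := by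
    intro j m
    induction j generalizing m with
    | zero => rfl
    | succ k ih => rw [Function.iterate_succ_apply, Function.iterate_succ_apply, ih]; rfl
  have key := unit_index σM T (fun t ht => hhom s t ht) p hp r hrank
    (fun m => by
      change ((∏ j ∈ Finset.range p, (⇑σM)^[j] m : M) : E) ∈ tE
      rw [Subgroup.val_finset_prod, Finset.prod_congr rfl (fun j _ => hMiter j m), ← hνE, htE]
      exact isOfFinOrder_iff_pow_eq_one.mpr ⟨p, hp.pos, m.2⟩)
    (by
      refine le_trans (Nat.card_le_card_of_injective (fun x : {t : T // σM t = t} =>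
        b ⟨x.1.1.1, congrArg Subtype.val x.2, ?_⟩) ?_) hB
      · have hx : s x.1.1.1 = x.1.1.1 := congrArg Subtype.val x.2
        have h3 : νE x.1.1.1 ^ p = 1 := x.1.1.2
        rw [hνE, Finset.prod_congr rfl (fun j _ => Function.iterate_fixed hx j),
          Finset.prod_const, Finset.card_range] at h3
        exact h3
      · intro x y h
        have h1 := congrArg Subtype.val (hb h)
        exact Subtype.ext (Subtype.ext (Subtype.ext h1)))
  classical
  refine ⟨M ⧸ (σM / MonoidHom.id M).range, ?_,
    fun u => if h : u ∈ M then QuotientGroup.mk ⟨u, h⟩ else 1, key.2, ?_⟩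
  · exact Nat.finite_of_card_ne_zero key.1
  · intro u u' hu hu' h
    have hu : u ∈ M := hu
    have hu' : u' ∈ M := hu'
    simp only at h
    rw [dif_pos hu, dif_pos hu', eq_comm, QuotientGroup.eq] at h
    obtain ⟨v, hv⟩ := h
    refine ⟨v, ?_⟩
    have := congrArg Subtype.val hv
    have : s v / v = u'⁻¹ * u := this
    rw [this, mul_inv_cancel_left]

theorem unit_bound (p : ℕ) (hp : p.Prime) (hpodd : Odd p) {K L : Type} [Field K] [Field L]
    [NumberField K] [NumberField L] [Algebra K L] [IsCyclotomicExtension {p} ℚ K]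
    (hdeg : Module.finrank K L = p) (σ : L ≃ₐ[K] L) (hσp : σ ^ p = 1)
    (hfix : ∀ x : L, σ x = x → ∃ y : K, algebraMap K L y = x) :
    ∃ (T : Type) (_ : Finite T) (q : (𝓞 L)ˣ → T), Nat.card T ≤ p ^ ((p - 1) / 2 + 1) ∧
      ∀ u u' : (𝓞 L)ˣ, (∏ j ∈ Finset.range p, actE (σ ^ j) u) ^ p = 1 →
        (∏ j ∈ Finset.range p, actE (σ ^ j) u') ^ p = 1 → q u = q u' →
        ∃ v : (𝓞 L)ˣ, u = u' * (actE σ v / v) := by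
  have := Fact.mk hp
  have : NeZero p := ⟨hp.ne_zero⟩
  let νE : (𝓞 L)ˣ →* (𝓞 L)ˣ := ∏ j ∈ Finset.range p, actE (σ ^ j)
  have hνE : ∀ u, νE u = ∏ j ∈ Finset.range p, actE (σ ^ j) u := fun u => by
    simp only [νE, MonoidHom.finset_prod_apply]
  let eK : (𝓞 K)ˣ →* (𝓞 L)ˣ := Units.map (algebraMap (𝓞 K) (𝓞 L) : 𝓞 K →* 𝓞 L)
  have heK : ∀ u, ((eK u : 𝓞 L) : L) = algebraMap K L (u : 𝓞 K) := fun u => rfl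
  have heKinj : Function.Injective eK := by
    intro u v h
    apply unitE_ext
    apply (algebraMap K L).injective
    rw [← heK, ← heK, h]
  have hroot : Nat.card (rootsOfUnity p L) ≤ p := card_rootsOfUnity L p
  have hb0 : ∀ t : (𝓞 L)ˣ, actE σ t = t → (t ^ p) ^ p = 1 →
      Units.map (algebraMap (𝓞 L) L : 𝓞 L →* L) t ∈ rootsOfUnity p L := by
    intro t hx h3
    have ht1 : σ ((t : 𝓞 L) : L) = (t : 𝓞 L) := by rw [← actE_coe, hx]
    obtain ⟨y, hy⟩ := hfix _ ht1
    have h4 : y ^ (p * p) = 1 := by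
      apply (algebraMap K L).injective
      rw [map_pow, hy, map_one, pow_mul]
      have := congrArg (fun z : (𝓞 L)ˣ => ((z : 𝓞 L) : L)) h3
      simpa using this
    have h5 : orderOf y ∣ p * p := orderOf_dvd_of_pow_eq_one h4
    have h6 : orderOf y ≠ 0 := by
      intro h; rw [h] at h5
      have := zero_dvd_iff.mp h5
      exact mul_ne_zero hp.ne_zero hp.ne_zero this
    have h7 := (IsPrimitiveRoot.orderOf y).dvd_of_isCyclotomicExtension p h6
    have h8 : orderOf y ∣ p := by
      have hco : Nat.Coprime (orderOf y) 2 := by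
        apply Nat.Coprime.coprime_dvd_left h5
        exact Nat.Coprime.mul_left (Nat.coprime_two_right.mpr hpodd) (Nat.coprime_two_right.mpr hpodd)
      exact hco.dvd_of_dvd_mul_left h7
    have h9 : y ^ p = 1 := orderOf_dvd_iff_pow_eq_one.mp h8
    rw [mem_rootsOfUnity]
    apply Units.ext
    change ((t : 𝓞 L) : L) ^ p = 1
    rw [← hy, ← map_pow, h9, map_one]
  have hr := (rank_cyc p hp hpodd hdeg).1
  rw [← Units.finrank_modTorsion, ← Units.finrank_modTorsion] at hr
  obtain ⟨T, hT, q, hq1, hq2⟩ := unit_core p hp ((p - 1) / 2) (Units.torsion K) (Units.torsion L) (fun x => Iff.rfl)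
    (fun x => Iff.rfl) hr (actE σ) νE
    (fun u => by rw [hνE]; exact Finset.prod_congr rfl (fun j _ => (actE_iter σ j u).symm))
    (fun u => by rw [actE_iter, hσp]; exact unitE_ext rfl) eK heKinj
    (fun x => by apply unitE_ext; rw [actE_coe, heK, AlgEquiv.commutes])
    (rootsOfUnity p L) hroot (fun t => ⟨_, hb0 t.1 t.2.1 t.2.2⟩)
    (by
      intro x y h
      have h1 := congrArg (fun z : rootsOfUnity p L => ((z : Lˣ) : L)) h
      have h2 : x.1 = y.1 := unitE_ext h1
      exact Subtype.ext h2)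
  refine ⟨T, hT, q, hq1, fun u u' hu hu' => hq2 u u' ?_ ?_⟩
  · rw [hνE]; exact hu
  · rw [hνE]; exact hu'

open scoped nonZeroDivisors

theorem ex_hf {K L : Type} [Field K] [Field L] (φ : K →+* L) :
    (𝓞 K)⁰ ≤ Submonoid.comap (RingOfIntegers.mapRingHom φ) (𝓞 L)⁰ := by
  intro x hx
  rw [Submonoid.mem_comap, mem_nonZeroDivisors_iff_ne_zero]
  rw [mem_nonZeroDivisors_iff_ne_zero] at hx
  intro h
  have h1 : φ (x : K) = 0 := congrArg (fun z : 𝓞 L => (z : L)) h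
  rw [map_eq_zero] at h1
  exact hx (RingOfIntegers.ext h1)

/-- extension of fractional ideals along a homomorphism of number fields -/
noncomputable def ex {K L : Type} [Field K] [Field L] [NumberField K] [NumberField L] (φ : K →+* L) :
    FractionalIdeal (𝓞 K)⁰ K →+* FractionalIdeal (𝓞 L)⁰ L :=
  FractionalIdeal.extendedHom' L (f := RingOfIntegers.mapRingHom φ) (ex_hf φ)

noncomputable def exU {K L : Type} [Field K] [Field L] [NumberField K] [NumberField L] (φ : K →+* L) :
    (FractionalIdeal (𝓞 K)⁰ K)ˣ →* (FractionalIdeal (𝓞 L)⁰ L)ˣ := Units.map (ex φ : _ →* _)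

theorem exU_val {K L : Type} [Field K] [Field L] [NumberField K] [NumberField L] (φ : K →+* L)
    (I : (FractionalIdeal (𝓞 K)⁰ K)ˣ) : (exU φ I : FractionalIdeal (𝓞 L)⁰ L) = ex φ I := rfl

section
variable {K L M : Type} [Field K] [Field L] [Field M] [NumberField K] [NumberField L] [NumberField M]

theorem ex_map (φ : K →+* L) (x : K) :
    IsLocalization.map (M := (𝓞 K)⁰) (T := (𝓞 L)⁰) L (RingOfIntegers.mapRingHom φ) (ex_hf φ) x = φ x := by
  have := IsLocalization.map_unique (M := (𝓞 K)⁰) (T := (𝓞 L)⁰) (Q := L)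
    (g := RingOfIntegers.mapRingHom φ) (ex_hf φ) φ
    (fun a => rfl)
  rw [this]

theorem ex_span (φ : K →+* L) (x : K) :
    ex φ (FractionalIdeal.spanSingleton _ x) = FractionalIdeal.spanSingleton _ (φ x) := by
  have := FractionalIdeal.extended_spanSingleton L (ex_hf φ) x
  rw [ex_map] at this
  exact this

theorem ex_ideal (φ : K →+* L) (I : Ideal (𝓞 K)) :
    ex φ (I : FractionalIdeal (𝓞 K)⁰ K) = (I.map (RingOfIntegers.mapRingHom φ) : Ideal (𝓞 L)) :=
  FractionalIdeal.extended_coeIdeal_eq_map L (ex_hf φ) I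

theorem ex_comp (φ : K →+* L) (ψ : L →+* M) (I : FractionalIdeal (𝓞 K)⁰ K) :
    ex ψ (ex φ I) = ex (ψ.comp φ) I :=
  congrArg (fun h => h I) (FractionalIdeal.extendedHom'_comp L (ex_hf φ) (W := M) (ex_hf ψ))

theorem ex_id (I : FractionalIdeal (𝓞 K)⁰ K) : ex (RingHom.id K) I = I := by
  have h : (ex (RingHom.id K) I : Submodule (𝓞 K) K) = (I : Submodule (𝓞 K) K) := by
    have h1 := FractionalIdeal.coe_extended_eq_span K (ex_hf (RingHom.id K)) I
    refine h1.trans ?_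
    have h2 : (⇑(IsLocalization.map (M := (𝓞 K)⁰) (T := (𝓞 K)⁰) K (RingOfIntegers.mapRingHom (RingHom.id K))
      (ex_hf (RingHom.id K))) '' (I : Set K)) = (I : Set K) := by
      ext x
      simp [ex_map]
    rw [h2]
    exact Submodule.span_eq _
  exact FractionalIdeal.coeToSubmodule_injective h

theorem ex_inj (φ : K →+* L) : Function.Injective (ex φ) := by
  let := φ.toAlgebra
  exact FractionalIdeal.extendedHom_injective (A := 𝓞 K) (K := K) L (𝓞 L)

theorem exU_inj (φ : K →+* L) : Function.Injective (exU φ) := by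
  intro x y h
  exact Units.ext (ex_inj φ (congrArg Units.val h))

theorem exU_comp (φ : K →+* L) (ψ : L →+* M) (I : (FractionalIdeal (𝓞 K)⁰ K)ˣ) :
    exU ψ (exU φ I) = exU (ψ.comp φ) I := Units.ext (ex_comp φ ψ I)

theorem exU_id (I : (FractionalIdeal (𝓞 K)⁰ K)ˣ) : exU (RingHom.id K) I = I := by
  apply Units.ext
  rw [exU_val, ex_id]

theorem exU_div (φ : K →+* L) (x : Kˣ) :
    exU φ (toPrincipalIdeal (𝓞 K) K x) = toPrincipalIdeal (𝓞 L) L (Units.map (φ : K →* L) x) := by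
  apply Units.ext
  have h1 : (exU φ (toPrincipalIdeal (𝓞 K) K x) : FractionalIdeal (𝓞 L)⁰ L) =
    ex φ (FractionalIdeal.spanSingleton _ (x : K)) := by rw [exU_val, coe_toPrincipalIdeal]
  rw [h1, ex_span, coe_toPrincipalIdeal, Units.coe_map, MonoidHom.coe_coe]

theorem mk_eq_one_div {I : (FractionalIdeal (𝓞 L)⁰ L)ˣ} (h : ClassGroup.mk L I = 1) :
    ∃ y : Lˣ, toPrincipalIdeal (𝓞 L) L y = I := by
  rw [ClassGroup.mk_eq_one_iff] at h
  obtain ⟨x, hx⟩ := h.principal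
  have hx' : FractionalIdeal.spanSingleton (𝓞 L)⁰ x = I := by
    apply FractionalIdeal.coeToSubmodule_injective
    exact (FractionalIdeal.coe_spanSingleton _ _).trans hx.symm
  exact mem_principal_ideals_iff.mpr ⟨x, hx'⟩

theorem div_eq_one_iff' (x : Lˣ) : toPrincipalIdeal (𝓞 L) L x = 1 ↔
    ∃ u : (𝓞 L)ˣ, Units.map (algebraMap (𝓞 L) L : 𝓞 L →* L) u = x := by
  constructor
  · intro h
    have h2 : ∀ y : Lˣ, toPrincipalIdeal (𝓞 L) L y = 1 → ∃ a : 𝓞 L, (a : L) = y := by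
      intro y hy
      have h1 : (FractionalIdeal.spanSingleton (𝓞 L)⁰ (y : L)) = 1 := by
        rw [← coe_toPrincipalIdeal, hy]; rfl
      have h2 : (y : L) ∈ (1 : FractionalIdeal (𝓞 L)⁰ L) := by
        rw [← h1]; exact FractionalIdeal.mem_spanSingleton_self _ _
      exact (FractionalIdeal.mem_one_iff _).mp h2
    obtain ⟨a, ha⟩ := h2 x h
    obtain ⟨b, hb⟩ := h2 x⁻¹ (by rw [map_inv, h, inv_one])
    have hab : a * b = 1 := by
      apply RingOfIntegers.ext
      have : (a : L) * (b : L) = 1 := by rw [ha, hb, Units.mul_inv]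
      exact this
    exact ⟨⟨a, b, hab, by rw [mul_comm, hab]⟩, Units.ext ha⟩
  · rintro ⟨u, rfl⟩
    apply Units.ext
    rw [coe_toPrincipalIdeal]
    apply le_antisymm
    · rw [FractionalIdeal.spanSingleton_le_iff_mem]
      exact (FractionalIdeal.mem_one_iff _).mpr ⟨u, rfl⟩
    · rw [Units.val_one, FractionalIdeal.one_le, FractionalIdeal.mem_spanSingleton]
      refine ⟨((u⁻¹ : (𝓞 L)ˣ) : 𝓞 L), ?_⟩
      rw [Algebra.smul_def]
      change algebraMap (𝓞 L) L _ * algebraMap (𝓞 L) L _ = 1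
      rw [← map_mul, Units.inv_mul, map_one]
end

theorem main_frame (p : ℕ) (hp : p.Prime) (hpodd : Odd p) {K L : Type} [Field K] [Field L]
    [NumberField K] [NumberField L] [Algebra K L] [IsCyclotomicExtension {p} ℚ K]
    (hdeg : Module.finrank K L = p) (σ : L ≃ₐ[K] L) (hσp : σ ^ p = 1)
    (hfix : ∀ x : L, σ x = x → ∃ y : K, algebraMap K L y = x)
    {ι : Type} [Fintype ι] (hι : Fintype.card ι = p) (A : ι → (FractionalIdeal (𝓞 L)⁰ L)ˣ)
    (c : ι → Lˣ)
    (hA : ∀ i, exU (σ : L →+* L) (A i) = toPrincipalIdeal (𝓞 L) L (c i) * A i)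
    (hc : ∀ i, (∏ j ∈ Finset.range p, (σ ^ j) (c i : L)) ^ p = 1)
    (h1 : ∀ d : ι → ℤ, (∀ i, |d i| < p) →
      ∏ i, (∏ j ∈ Finset.range p, (σ ^ j) (c i : L)) ^ d i = 1 → ∏ i, c i ^ d i = 1)
    (h2 : ∀ d : ι → ℤ, (∀ i, |d i| < p) →
      ∏ i, (∏ j ∈ Finset.range p, (σ ^ j) (c i : L)) ^ d i = 1 →
      ∏ i, A i ^ d i ∈ (exU (algebraMap K L)).range → d = 0)
    (hAp : ∀ i, ∃ y : Lˣ, ∃ b ∈ (exU (algebraMap K L)).range, A i ^ p = toPrincipalIdeal (𝓞 L) L y * b) :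
    (p - 1) / 2 ≤ pRank p (ClassGroup (𝓞 L)) := by
  obtain ⟨T, hT, q, hq1, hq2⟩ := unit_bound p hp hpodd hdeg σ hσp hfix
  set IK := (exU (algebraMap K L)).range with hIK
  set div := toPrincipalIdeal (𝓞 L) L with hdiv
  let H : Subgroup (ClassGroup (𝓞 L)) := IK.map (ClassGroup.mk L)
  let φ : (FractionalIdeal (𝓞 L)⁰ L)ˣ →* ClassGroup (𝓞 L) ⧸ H :=
    (QuotientGroup.mk' H).comp (ClassGroup.mk L)
  let nrm : Lˣ →* Lˣ := ∏ j ∈ Finset.range p, Units.map ((σ ^ j : L ≃ₐ[K] L) : L →* L)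
  have hnrm : ∀ x, ((nrm x : Lˣ) : L) = ∏ j ∈ Finset.range p, (σ ^ j) (x : L) := by
    intro x
    simp only [nrm, MonoidHom.finset_prod_apply, Units.coe_prod]
    rfl
  let sX : Lˣ →* Lˣ := Units.map (σ : L →* L)
  have hnrms : ∀ x, nrm (sX x) = nrm x := by
    intro x
    apply Units.ext
    rw [hnrm, hnrm]
    have : ∀ j, (σ ^ j) ((sX x : Lˣ) : L) = (σ ^ (j + 1)) (x : L) := fun j => by
      rw [pow_succ, AlgEquiv.mul_apply]; rfl
    rw [Finset.prod_congr rfl (fun j _ => this j)]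
    have h1 := Finset.prod_range_succ (fun j => (σ ^ j) (x : L)) p
    have h2 := Finset.prod_range_succ' (fun j => (σ ^ j) (x : L)) p
    rw [h1, hσp, pow_zero] at h2
    exact (mul_right_cancel₀ x.ne_zero h2).symm
  have hprod : ∀ d : ι → ℤ, ((∏ i, nrm (c i) ^ d i : Lˣ) : L) =
      ∏ i, (∏ j ∈ Finset.range p, (σ ^ j) (c i : L)) ^ d i := by
    intro d
    rw [Units.coe_prod]
    refine Finset.prod_congr rfl fun i _ => ?_
    rw [Units.val_zpow_eq_zpow_val, hnrm]
  classical
  let qX : Lˣ → T := fun x => if h : div x = 1 then q ((div_eq_one_iff' x).mp h).choose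
    else q 1
  have hcoe : ∀ u : (𝓞 L)ˣ, ((Units.map (algebraMap (𝓞 L) L : 𝓞 L →* L) u : Lˣ) : L) = ((u : 𝓞 L) : L) :=
    fun u => rfl
  have hnE : ∀ u : (𝓞 L)ˣ, nrm (Units.map (algebraMap (𝓞 L) L : 𝓞 L →* L) u) ^ p = 1 →
      (∏ j ∈ Finset.range p, actE (σ ^ j) u) ^ p = 1 := by
    intro u hu
    apply unitE_ext
    have := congrArg (fun z : Lˣ => (z : L)) hu
    simp only [Units.val_pow_eq_pow_val, hnrm, hcoe] at this
    simp only [Units.val_pow_eq_pow_val, map_pow, Units.coe_prod, map_prod]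
    exact this
  have key := box_lemma div (exU (σ : L →+* L)) sX (fun x => exU_div (σ : L →+* L) x) IK
    (by
      rintro _ ⟨b, rfl⟩
      rw [exU_comp]
      congr 1
      have : (σ : L →+* L).comp (algebraMap K L) = algebraMap K L := by
        ext x; exact σ.commutes x
      rw [this])
    (by
      intro x hx
      obtain ⟨y, hy⟩ := hfix x (congrArg Units.val hx)
      have hy0 : y ≠ 0 := by
        rintro rfl; rw [map_zero] at hy; exact x.ne_zero hy.symm
      refine ⟨toPrincipalIdeal (𝓞 K) K (Units.mk0 y hy0), ?_⟩
      rw [exU_div]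
      congr 1
      exact Units.ext hy)
    p nrm hnrms qX
    (by
      intro u u' hu hun hu' hun' hqq
      simp only [qX, dif_pos hu, dif_pos hu'] at hqq
      set v := ((div_eq_one_iff' u).mp hu).choose with hv
      set v' := ((div_eq_one_iff' u').mp hu').choose with hv'
      have e1 := ((div_eq_one_iff' u).mp hu).choose_spec
      have e2 := ((div_eq_one_iff' u').mp hu').choose_spec
      rw [← hv] at e1
      rw [← hv'] at e2
      obtain ⟨w, hw⟩ := hq2 v v' (hnE v (by rw [e1]; exact hun)) (hnE v' (by rw [e2]; exact hun')) hqq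
      refine ⟨Units.map (algebraMap (𝓞 L) L : 𝓞 L →* L) w, (div_eq_one_iff' _).mpr ⟨w, rfl⟩, ?_⟩
      rw [← e1, ← e2, hw, map_mul, _root_.map_div]
      congr 1)
    A c hA (fun i => by apply Units.ext; rw [Units.val_pow_eq_pow_val, hnrm]; exact hc i)
    (fun d hd hd1 => h1 d hd (by rw [← hprod, hd1]; rfl))
    (fun d hd hd1 => h2 d hd (by rw [← hprod, hd1]; rfl))
    φ
    (by
      intro x hx
      have : ClassGroup.mk L x ∈ H := (QuotientGroup.eq_one_iff _).mp hx
      obtain ⟨b, hb, hbx⟩ := this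
      have h3 : ClassGroup.mk L (x / b) = 1 := by rw [_root_.map_div, hbx, div_self']
      obtain ⟨y, hy⟩ := mk_eq_one_div h3
      exact ⟨y, b, hb, by rw [hdiv, hy, div_mul_cancel]⟩)
  rw [hι] at key
  have : Finite (ClassGroup (𝓞 L)) := inferInstance
  have hdiv1 : ∀ y, φ (div y) = 1 := by
    intro y
    have : ClassGroup.mk L (div y) = 1 := by
      rw [ClassGroup.mk_eq_one_iff]
      exact ⟨y, by rw [hdiv, coe_toPrincipalIdeal, FractionalIdeal.coe_spanSingleton]⟩
    change QuotientGroup.mk' H (ClassGroup.mk L (div y)) = 1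
    rw [this, map_one]
  have hb1 : ∀ b ∈ IK, φ b = 1 := fun b hb => (QuotientGroup.eq_one_iff _).mpr ⟨b, hb, rfl⟩
  refine le_pRank_of_quotient p hp H (Set.range fun e : ι → Fin p => φ (∏ i, A i ^ (e i : ℕ))) ?_ _ ?_
  · rintro _ ⟨e, rfl⟩
    simp only [map_prod, map_pow]
    rw [← Finset.prod_pow]
    refine Finset.prod_eq_one fun i _ => ?_
    obtain ⟨y, b, hb, hy⟩ := hAp i
    rw [pow_right_comm, ← map_pow, hy, map_mul, hdiv1, hb1 b hb, one_mul, one_pow]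
  · have h3 : p ^ p ≤ p ^ ((p - 1) / 2 + 1) * Nat.card (Set.range fun e : ι → Fin p => φ (∏ i, A i ^ (e i : ℕ))) :=
      key.trans (Nat.mul_le_mul_right _ hq1)
    have h4 : p ^ p = p ^ ((p - 1) / 2 + 1) * p ^ ((p - 1) / 2) := by
      rw [← pow_add]
      congr 1
      obtain ⟨k, hk⟩ := hpodd
      omega
    rw [h4] at h3
    exact Nat.le_of_mul_le_mul_left h3 (pow_pos hp.pos _)

open IsDedekindDomain in
theorem fi_eq_one_of_count {K : Type} [Field K] [NumberField K]
    (X : (FractionalIdeal (𝓞 K)⁰ K)ˣ)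
    (h : ∀ v : HeightOneSpectrum (𝓞 K), FractionalIdeal.count K v (X : FractionalIdeal (𝓞 K)⁰ K) = 0) :
    X = 1 := by
  apply Units.ext
  have h1 := FractionalIdeal.finprod_heightOneSpectrum_factorization' K (I := (X : FractionalIdeal (𝓞 K)⁰ K)) (Units.ne_zero X)
  rw [← h1]
  rw [finprod_eq_one_of_forall_eq_one]
  · rfl
  · intro v
    rw [h v, zpow_zero]

theorem fi_torsion_free {K : Type} [Field K] [NumberField K] (p : ℕ) (hp : p ≠ 0)
    (X : (FractionalIdeal (𝓞 K)⁰ K)ˣ) (h : X ^ p = 1) : X = 1 := by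
  apply fi_eq_one_of_count
  intro v
  have h1 := FractionalIdeal.count_pow K v p (X : FractionalIdeal (𝓞 K)⁰ K)
  rw [← Units.val_pow_eq_pow_val, h, Units.val_one, FractionalIdeal.count_one] at h1
  have : (p : ℤ) ≠ 0 := by exact_mod_cast hp
  have h2 := h1.symm
  rcases mul_eq_zero.1 h2 with h3 | h3
  · exact absurd h3 this
  · exact h3

open IsDedekindDomain in
noncomputable def prU {K : Type} [Field K] [NumberField K] (v : HeightOneSpectrum (𝓞 K)) :
    (FractionalIdeal (𝓞 K)⁰ K)ˣ :=
  Units.mk0 (v.asIdeal : FractionalIdeal (𝓞 K)⁰ K) (FractionalIdeal.coeIdeal_ne_zero.2 v.ne_bot)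

open IsDedekindDomain in
theorem prU_val {K : Type} [Field K] [NumberField K] (v : HeightOneSpectrum (𝓞 K)) :
    ((prU v : (FractionalIdeal (𝓞 K)⁰ K)ˣ) : FractionalIdeal (𝓞 K)⁰ K) = (v.asIdeal : FractionalIdeal (𝓞 K)⁰ K) := rfl

open IsDedekindDomain in
theorem indep_count {K : Type} [Field K] [NumberField K] (p : ℕ) {ι : Type} [Fintype ι]
    (v : ι → HeightOneSpectrum (𝓞 K)) (hv : Function.Injective v) (d : ι → ℤ)
    (B : (FractionalIdeal (𝓞 K)⁰ K)ˣ) (h : ∏ i, prU (v i) ^ d i = B ^ p) (i : ι) :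
    (p : ℤ) ∣ d i := by
  classical
  have h1 := congrArg (fun z : (FractionalIdeal (𝓞 K)⁰ K)ˣ => FractionalIdeal.count K (v i) (z : FractionalIdeal (𝓞 K)⁰ K)) h
  beta_reduce at h1
  rw [Units.val_pow_eq_pow_val, FractionalIdeal.count_pow, Units.coe_prod, FractionalIdeal.count_prod] at h1
  · have h2 : ∀ j, FractionalIdeal.count K (v i) ((prU (v j) ^ d j : (FractionalIdeal (𝓞 K)⁰ K)ˣ) : FractionalIdeal (𝓞 K)⁰ K)
        = if j = i then d i else 0 := by
      intro j
      rw [Units.val_zpow_eq_zpow_val, FractionalIdeal.count_zpow, prU_val]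
      split_ifs with hj
      · subst hj
        rw [FractionalIdeal.count_self, mul_one]
      · rw [FractionalIdeal.count_maximal_coprime, mul_zero]
        exact fun h => hj (hv h)
    rw [Finset.sum_congr rfl (fun j _ => h2 j)] at h1
    simp at h1
    exact ⟨_, h1⟩
  · intro j _
    exact Units.ne_zero _

theorem zero_of_dvd_lt (p : ℕ) (d : ℤ) (h : (p : ℤ) ∣ d) (h2 : |d| < p) : d = 0 :=
  Int.eq_zero_of_abs_lt_dvd h h2

open IsDedekindDomain in
theorem fixed_of_pow {K L : Type} [Field K] [Field L] [NumberField K] [NumberField L] [Algebra K L]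
    (p : ℕ) (hp : p ≠ 0) (σ : L ≃ₐ[K] L) (A : (FractionalIdeal (𝓞 L)⁰ L)ˣ)
    (B : (FractionalIdeal (𝓞 K)⁰ K)ˣ) (h : A ^ p = exU (algebraMap K L) B) :
    exU (σ : L →+* L) A = A := by
  have h1 : exU (σ : L →+* L) A ^ p = A ^ p := by
    rw [← map_pow, h, exU_comp]
    congr 2
    ext x
    simp
  have h2 : (exU (σ : L →+* L) A * A⁻¹) = 1 := by
    apply fi_torsion_free p hp
    rw [mul_pow, h1, inv_pow, mul_inv_cancel]
  exact mul_inv_eq_one.1 h2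

open IsDedekindDomain in
theorem case1_frame (p : ℕ) (hp : p.Prime) (hpodd : Odd p) {K L : Type} [Field K] [Field L]
    [NumberField K] [NumberField L] [Algebra K L] [IsCyclotomicExtension {p} ℚ K]
    (hdeg : Module.finrank K L = p) (σ : L ≃ₐ[K] L) (hσp : σ ^ p = 1)
    (hfix : ∀ x : L, σ x = x → ∃ y : K, algebraMap K L y = x)
    {ι : Type} [Fintype ι] (hι : Fintype.card ι = p)
    (v : ι → HeightOneSpectrum (𝓞 K)) (hv : Function.Injective v)
    (A : ι → (FractionalIdeal (𝓞 L)⁰ L)ˣ)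
    (hA : ∀ i, A i ^ p = exU (algebraMap K L) (prU (v i))) :
    (p - 1) / 2 ≤ pRank p (ClassGroup (𝓞 L)) := by
  apply main_frame p hp hpodd hdeg σ hσp hfix hι A (fun _ => 1)
  · intro i
    rw [map_one, one_mul]
    exact fixed_of_pow p hp.ne_zero σ _ _ (hA i)
  · intro i
    simp
  · intro d _ _
    simp
  · intro d hd _ hB
    obtain ⟨B, hB⟩ := hB
    have h3 : ∏ i, prU (v i) ^ d i = B ^ p := by
      apply exU_inj (algebraMap K L)
      rw [map_pow, hB, map_prod, ← Finset.prod_pow]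
      refine Finset.prod_congr rfl fun i _ => ?_
      rw [map_zpow, ← hA, ← zpow_natCast, ← zpow_natCast, ← zpow_mul, ← zpow_mul, mul_comm]
    funext i
    exact zero_of_dvd_lt p _ (indep_count p v hv d B h3 i) (hd i)
  · intro i
    exact ⟨1, _, ⟨_, rfl⟩, by rw [map_one, one_mul, hA]⟩

open IsDedekindDomain in
theorem case2_frame (p : ℕ) (hp : p.Prime) (hpodd : Odd p) {K L : Type} [Field K] [Field L]
    [NumberField K] [NumberField L] [Algebra K L] [IsCyclotomicExtension {p} ℚ K]
    (hdeg : Module.finrank K L = p) (σ : L ≃ₐ[K] L) (hσp : σ ^ p = 1)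
    (hfix : ∀ x : L, σ x = x → ∃ y : K, algebraMap K L y = x)
    {ι : Type} [Fintype ι] (hι : Fintype.card ι = p - 1)
    (v : ι → HeightOneSpectrum (𝓞 K)) (hv : Function.Injective v)
    (A : ι → (FractionalIdeal (𝓞 L)⁰ L)ˣ)
    (hA : ∀ i, A i ^ p = exU (algebraMap K L) (prU (v i)))
    (J : (FractionalIdeal (𝓞 L)⁰ L)ˣ) (c : Lˣ)
    (hJ : exU (σ : L →+* L) J = toPrincipalIdeal (𝓞 L) L c * J) (η : L)
    (hη : η ^ p = 1) (hη1 : η ≠ 1) (hc : ∏ j ∈ Finset.range p, (σ ^ j) (c : L) = η)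
    (hJp : ∃ y, ∃ b ∈ (exU (algebraMap K L)).range, J ^ p = toPrincipalIdeal (𝓞 L) L y * b) :
    (p - 1) / 2 ≤ pRank p (ClassGroup (𝓞 L)) := by
  have := Fact.mk hp
  have hη0 : η ≠ 0 := by
    rintro rfl
    rw [zero_pow hp.ne_zero] at hη
    exact zero_ne_one hη
  have hord : orderOf (Units.mk0 η hη0) = p := orderOf_eq_prime (Units.ext (by simpa using hη)) (fun h => hη1 (by simpa using congrArg Units.val h))
  have key : ∀ d : Option ι → ℤ, (∀ i, |d i| < p) →
     ∏ i, (∏ j ∈ Finset.range p, (σ ^ j) (((fun o : Option ι => o.elim c (fun _ => 1)) i : Lˣ) : L)) ^ d i = 1 → d none = 0 := by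
    intro d hd h
    rw [Fintype.prod_option] at h
    simp only [Option.elim_none, Option.elim_some, hc] at h
    simp only [Units.val_one, map_one, Finset.prod_const_one, one_zpow, mul_one] at h
    apply zero_of_dvd_lt p _ _ (hd none)
    have := (orderOf_dvd_iff_zpow_eq_one (x := Units.mk0 η hη0)).2 (Units.ext (by rw [Units.val_zpow_eq_zpow_val]; exact h))
    rwa [hord] at this
  apply main_frame p hp hpodd hdeg σ hσp hfix (ι := Option ι) (by rw [Fintype.card_option, hι]; have := hp.pos; omega)
    (fun o => o.elim J A) (fun o => o.elim c (fun _ => 1))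
  · rintro (_ | i)
    · exact hJ
    · simp only [Option.elim_some]
      rw [map_one, one_mul]
      exact fixed_of_pow p hp.ne_zero σ _ _ (hA i)
  · rintro (_ | i)
    · simp only [Option.elim_none, hc, hη]
    · simp
  · intro d hd h
    have := key d hd h
    rw [Fintype.prod_option]
    simp [this]
  · intro d hd h hB
    have h0 := key d hd h
    obtain ⟨B, hB⟩ := hB
    rw [Fintype.prod_option, h0] at hB
    simp only [zpow_zero, one_mul, Option.elim_some] at hB
    have h3 : ∏ i, prU (v i) ^ d (some i) = B ^ p := by
      apply exU_inj (algebraMap K L)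
      rw [map_pow, hB, map_prod, ← Finset.prod_pow]
      refine Finset.prod_congr rfl fun i _ => ?_
      rw [map_zpow, ← hA, ← zpow_natCast, ← zpow_natCast, ← zpow_mul, ← zpow_mul, mul_comm]
    funext i
    cases i with
    | none => exact h0
    | some i =>
      exact zero_of_dvd_lt p _ (indep_count p v hv (fun i => d (some i)) B h3 i) (hd _)
  · rintro (_ | i)
    · exact hJp
    · exact ⟨1, _, ⟨_, rfl⟩, by simp only [Option.elim_some]; rw [map_one, one_mul, hA]⟩

theorem isIntegral_algebraMap_natCast {L : Type} [Field L] (n : ℕ) : IsIntegral ℤ (n : L) := by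
  have h := isIntegral_algebraMap (R := ℤ) (A := L) (x := (n : ℤ))
  simpa using h

theorem ideal_pow_root {L : Type} [Field L] [NumberField L] (I J C : Ideal (𝓞 L)) (p : ℕ)
    (hIJ : IsCoprime I J) (h : I * J = C ^ p) : ∃ A : Ideal (𝓞 L), I = A ^ p :=
  exists_eq_pow_of_mul_eq_pow_of_coprime hIJ h

theorem coprime_of_prime_not_dvd {L : Type} [Field L] [NumberField L] (P Q : Ideal (𝓞 L))
    [hP : P.IsPrime] (hP0 : P ≠ ⊥) (h : ¬ P ∣ Q) : IsCoprime P Q := by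
  have hmax : P.IsMaximal := Ideal.IsPrime.isMaximal hP hP0
  rw [Ideal.isCoprime_iff_sup_eq]
  rcases (hmax.eq_of_le (J := P ⊔ Q)) with h1
  by_contra h2
  apply h
  rw [Ideal.dvd_iff_le]
  rw [h1 h2 le_sup_left]
  exact le_sup_right

theorem unram_cyc (q m : ℕ) [Fact q.Prime] [NeZero m] (K : Type) [Field K] [NumberField K]
    [IsCyclotomicExtension {m} ℚ K] (hqm : ¬ q ∣ m) (P : Ideal (𝓞 K)) [P.IsPrime]
    [P.LiesOver (Ideal.span {(q : ℤ)})] :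
    ∃ Q : Ideal (𝓞 K), Ideal.span {(q : 𝓞 K)} = P * Q ∧ IsCoprime P Q ∧ P ≠ ⊥ := by
  have h1 := IsCyclotomicExtension.Rat.ramificationIdx_eq_of_not_dvd q K P hqm
  have hmap : (Ideal.span {(q : ℤ)}).map (algebraMap ℤ (𝓞 K)) = Ideal.span {(q : 𝓞 K)} := by
    rw [Ideal.map_span]
    simp
  have hq0 : (q : 𝓞 K) ≠ 0 := by
    exact_mod_cast (Fact.out : q.Prime).ne_zero
  have hne : (Ideal.span {(q : ℤ)}).map (algebraMap ℤ (𝓞 K)) ≠ ⊥ := by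
    rw [hmap, Ne, Ideal.span_singleton_eq_bot]
    exact hq0
  rw [Ideal.IsDedekindDomain.ramificationIdx_eq_multiplicity (Ideal.span {(q : ℤ)}) P hne, hmap] at h1
  rw [hmap] at hne
  have hle : P ∣ Ideal.span {(q : 𝓞 K)} := by
    rw [Ideal.dvd_iff_le, ← hmap, Ideal.map_le_iff_le_comap]
    exact (Ideal.over_def P (Ideal.span {(q : ℤ)})).le
  obtain ⟨Q, hQ⟩ := hle
  have hP0 : P ≠ ⊥ := by
    rintro rfl
    rw [hQ] at hne
    simp at hne
  refine ⟨Q, hQ, ?_, hP0⟩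
  apply coprime_of_prime_not_dvd P Q hP0
  rintro ⟨R, rfl⟩
  have hfin : FiniteMultiplicity P (Ideal.span {(q : 𝓞 K)}) := by
    apply FiniteMultiplicity.of_prime_left
    · exact Ideal.prime_of_isPrime hP0 inferInstance
    · exact hne
  have h3 : P ^ 2 ∣ Ideal.span {(q : 𝓞 K)} := ⟨R, by rw [hQ, pow_two, mul_assoc]⟩
  have h4 := hfin.le_multiplicity_of_pow_dvd h3
  omega

theorem not_pow_cyc (q m p : ℕ) (hp : p.Prime) [Fact q.Prime] [NeZero m] (K : Type) [Field K]
    [NumberField K] [IsCyclotomicExtension {m} ℚ K] (hqm : ¬ q ∣ m) (b : K) : b ^ p ≠ (q : K) := by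
  intro hb
  obtain ⟨⟨P, hP1, hP2⟩⟩ := (Ideal.span {(q : ℤ)}).nonempty_primesOver (S := 𝓞 K)
  obtain ⟨Q, hQ, hco, hP0⟩ := unram_cyc q m K hqm P
  have hinteg : IsIntegral ℤ b := by
    apply IsIntegral.of_pow hp.pos
    rw [hb]
    exact isIntegral_algebraMap_natCast _
  let a : 𝓞 K := ⟨b, hinteg⟩
  have ha : a ^ p = (q : 𝓞 K) := RingOfIntegers.ext (by push_cast; exact hb)
  obtain ⟨A, hA⟩ := ideal_pow_root P Q (Ideal.span {a}) p hco (by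
      rw [← hQ, Ideal.span_singleton_pow, ha])
  have hpr := Ideal.prime_of_isPrime hP0 hP1
  rw [hA] at hpr
  exact not_prime_pow hp.ne_one hpr

theorem root_of_ideal {K L : Type} [Field K] [Field L] [NumberField K] [NumberField L] (φ : K →+* L)
    (p : ℕ) (hp : p ≠ 0) (I : Ideal (𝓞 K)) (hI : (I : FractionalIdeal (𝓞 K)⁰ K) ≠ 0) (A : Ideal (𝓞 L))
    (h : I.map (RingOfIntegers.mapRingHom φ) = A ^ p) :
    ∃ U : (FractionalIdeal (𝓞 L)⁰ L)ˣ, U ^ p = exU φ (Units.mk0 _ hI) := by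
  have h1 : ((A : FractionalIdeal (𝓞 L)⁰ L)) ^ p = ex φ I := by
    rw [ex_ideal, h, FractionalIdeal.coeIdeal_pow]
  have h2 : (A : FractionalIdeal (𝓞 L)⁰ L) ≠ 0 := by
    intro h3
    rw [h3, zero_pow hp] at h1
    apply hI
    apply ex_inj φ
    rw [← h1, map_zero]
  refine ⟨Units.mk0 _ h2, ?_⟩
  apply Units.ext
  rw [exU_val, Units.val_pow_eq_pow_val, Units.val_mk0, Units.val_mk0, h1]

open IsDedekindDomain in
theorem root_of_prime {K L : Type} [Field K] [Field L] [NumberField K] [NumberField L] (φ : K →+* L)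
    (p N : ℕ) (hp : p ≠ 0) (α : L) (hα : α ^ p = N) (v : HeightOneSpectrum (𝓞 K)) (Q : Ideal (𝓞 K))
    (hQ : Ideal.span {(N : 𝓞 K)} = v.asIdeal * Q) (hco : IsCoprime v.asIdeal Q) :
    ∃ U : (FractionalIdeal (𝓞 L)⁰ L)ˣ, U ^ p = exU φ (prU v) := by
  have hinteg : IsIntegral ℤ α := by
    apply IsIntegral.of_pow (Nat.pos_of_ne_zero hp)
    rw [hα]
    exact isIntegral_algebraMap_natCast _
  let a : 𝓞 L := ⟨α, hinteg⟩
  have ha : a ^ p = (N : 𝓞 L) := RingOfIntegers.ext (by push_cast; exact hα)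
  obtain ⟨A, hA⟩ := ideal_pow_root (v.asIdeal.map (RingOfIntegers.mapRingHom φ))
    (Q.map (RingOfIntegers.mapRingHom φ)) (Ideal.span {a}) p
    (hco.map (Ideal.mapHom (RingOfIntegers.mapRingHom φ))) (by
      rw [← Ideal.map_mul, ← hQ, Ideal.map_span, Ideal.span_singleton_pow, ha]
      simp)
  exact root_of_ideal φ p hp _ _ A hA

theorem card_primes_cyc (N m : ℕ) [Fact N.Prime] [NeZero m] (K : Type) [Field K] [NumberField K]
    [IsCyclotomicExtension {m} ℚ K] (hNm : ¬ N ∣ m) (h1 : N ≡ 1 [MOD m]) :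
    (Ideal.primesOver (Ideal.span {(N : ℤ)}) (𝓞 K)).ncard = m.totient := by
  have hg : IsGalois ℚ K := IsCyclotomicExtension.isGalois {m} ℚ K
  have h := Ideal.ncard_primesOver_mul_ramificationIdxIn_mul_inertiaDegIn (Ideal.span {(N : ℤ)}) (𝓞 K) Gal(K/ℚ)
  rw [IsCyclotomicExtension.Rat.ramificationIdxIn_eq_of_not_dvd N K hNm,
    IsCyclotomicExtension.Rat.inertiaDegIn_eq_of_not_dvd N K hNm,
    IsGalois.card_aut_eq_finrank, IsCyclotomicExtension.Rat.finrank m K] at h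
  have h2 : (N : ZMod m) = 1 := by
    have := (ZMod.natCast_eq_natCast_iff N 1 m).2 h1
    simpa using this
  rwa [h2, orderOf_one, mul_one, mul_one] at h

theorem kummer_setup (p : ℕ) (hp : p.Prime) {K L : Type} [Field K] [Field L] [Algebra K L]
    [FiniteDimensional K L]
    (ζ : K) (hζ : IsPrimitiveRoot ζ p) (a : K) (ha : ∀ b : K, b ^ p ≠ a) (α : L)
    (hα : α ^ p = algebraMap K L a) (htop : IntermediateField.adjoin K {α} = ⊤) :
    Module.finrank K L = p ∧ IsGalois K L ∧ ∃ σ : L ≃ₐ[K] L, σ α = algebraMap K L ζ * α ∧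
      σ ^ p = 1 ∧ (∀ x : L, σ x = x → ∃ y : K, algebraMap K L y = x) ∧
      ∀ g : L ≃ₐ[K] L, g ∈ Subgroup.zpowers σ := by
  have : NeZero p := ⟨hp.ne_zero⟩
  have H : Irreducible (X ^ p - C a) := X_pow_sub_C_irreducible_of_prime hp ha
  have hmin : minpoly K α = X ^ p - C a := by
    symm
    apply minpoly.eq_of_irreducible_of_monic H
    · simp [hα]
    · exact monic_X_pow_sub_C _ hp.ne_zero
  have hinteg : IsIntegral K α := Algebra.IsIntegral.isIntegral α
  have hdeg : Module.finrank K L = p := by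
    have h1 := IntermediateField.adjoin.finrank hinteg
    rw [htop, IntermediateField.finrank_top', hmin, natDegree_X_pow_sub_C] at h1
    exact h1
  have hζ' : (primitiveRoots p K).Nonempty := ⟨ζ, (mem_primitiveRoots hp.pos).2 hζ⟩
  have hspl : IsSplittingField K L (X ^ p - C a) := by
    have h1 := isSplittingField_X_pow_sub_C_of_root_adjoin_eq_top (K := K) (L := L) (a := a) (α := α)
      (by rw [hdeg]; exact hζ') (by rw [hdeg]; exact hα) htop
    rwa [hdeg] at h1
  have hgal : IsGalois K L := isGalois_of_isSplittingField_X_pow_sub_C hζ' H L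
  let e := autEquivZmod H L hζ
  let σ : L ≃ₐ[K] L := e.symm (Multiplicative.ofAdd (1 : ZMod p))
  have hσα : σ α = algebraMap K L ζ * α := by
    have := autEquivZmod_symm_apply_natCast H L hα hζ 1
    rw [Nat.cast_one, pow_one, Algebra.smul_def] at this
    exact this
  have hgen : ∀ g : L ≃ₐ[K] L, g ∈ Subgroup.zpowers σ := by
    intro g
    refine ⟨((Multiplicative.toAdd (e g)).val : ℤ), ?_⟩
    apply e.injective
    simp only [σ]
    rw [map_zpow, MulEquiv.apply_symm_apply]
    rw [← ofAdd_zsmul]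
    simp
  refine ⟨hdeg, hgal, σ, hσα, ?_, ?_, hgen⟩
  · apply e.injective
    simp only [σ]
    rw [map_pow, MulEquiv.apply_symm_apply, map_one e, ← ofAdd_nsmul]
    simp
  · intro x hx
    have h1 : x ∈ (⊥ : IntermediateField K L) := by
      rw [IsGalois.mem_bot_iff_fixed]
      intro g
      have h2 : Subgroup.zpowers σ ≤ MulAction.stabilizer (L ≃ₐ[K] L) x := by
        rw [Subgroup.zpowers_le]
        exact hx
      exact h2 (hgen g)
    exact IntermediateField.mem_bot.1 h1

open IsDedekindDomain in
theorem primes_data (p N : ℕ) (hp : p.Prime) (hN : N.Prime) (hNp : N ≠ p) (hmod : N ≡ 1 [MOD p])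
    {K L : Type} [Field K] [Field L] [NumberField K] [NumberField L] [IsCyclotomicExtension {p} ℚ K]
    (φ : K →+* L) (α : L) (hα : α ^ p = N) :
    ∃ (ι : Type) (_ : Fintype ι) (v : ι → HeightOneSpectrum (𝓞 K))
      (A : ι → (FractionalIdeal (𝓞 L)⁰ L)ˣ), Fintype.card ι = p - 1 ∧ Function.Injective v ∧
      (∀ i, A i ^ p = exU φ (prU (v i))) ∧ ∀ i, (N : 𝓞 K) ∈ (v i).asIdeal := by
  have := Fact.mk hN
  have : NeZero p := ⟨hp.ne_zero⟩
  have hnd : ¬ N ∣ p := fun h => hNp ((Nat.prime_dvd_prime_iff_eq hN hp).1 h)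
  let S := Ideal.primesOver (Ideal.span {(N : ℤ)}) (𝓞 K)
  have hcard : S.ncard = p - 1 := by
    rw [card_primes_cyc N p K hnd hmod, Nat.totient_prime hp]
  have hfin : S.Finite := by
    apply Set.finite_of_ncard_ne_zero
    rw [hcard]
    have := hp.two_le
    omega
  have hpr : ∀ P : S, P.1.IsPrime := fun P => P.2.1
  have hlo : ∀ P : S, P.1.LiesOver (Ideal.span {(N : ℤ)}) := fun P => P.2.2
  have hd : ∀ P : S, ∃ Q : Ideal (𝓞 K), Ideal.span {(N : 𝓞 K)} = P.1 * Q ∧ IsCoprime P.1 Q ∧ P.1 ≠ ⊥ := by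
    intro P
    have := hpr P
    have := hlo P
    exact unram_cyc N p K hnd P.1
  choose Q hQ hco hne using hd
  let v : S → HeightOneSpectrum (𝓞 K) := fun P => ⟨P.1, hpr P, hne P⟩
  have hA : ∀ P : S, ∃ U : (FractionalIdeal (𝓞 L)⁰ L)ˣ, U ^ p = exU φ (prU (v P)) :=
    fun P => root_of_prime φ p N hp.ne_zero α hα (v P) (Q P) (hQ P) (hco P)
  choose A hA using hA
  refine ⟨S, hfin.fintype, v, A, ?_, ?_, hA, ?_⟩
  · rw [← hcard, Set.ncard_eq_toFinset_card' S, Set.toFinset_card]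
  · intro P P' h
    exact Subtype.ext (congrArg HeightOneSpectrum.asIdeal h)
  · intro P
    have : Ideal.span {(N : 𝓞 K)} ≤ P.1 := by
      rw [hQ P]
      exact (Ideal.mul_le_left : P.1 * Q P ≤ P.1)
    exact this (Ideal.mem_span_singleton_self _)

theorem case1_num (p N : ℕ) (hp : p.Prime) (hmod : N ≡ 1 [MOD p]) (h2 : ¬ N ≡ 1 [MOD p ^ 2]) :
    ∃ m : ℤ, (N : ℤ) - (N : ℤ) ^ p = p * m ∧ IsCoprime (p : ℤ) m := by
  have h1 : (p : ℤ) ∣ (N : ℤ) - 1 := by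
    have := (Nat.modEq_iff_dvd.1 hmod.symm)
    simpa using this
  have h3 : (p : ℤ) ^ 2 ∣ (N : ℤ) ^ p - 1 := by
    have := dvd_sub_pow_of_dvd_sub (R := ℤ) (p := p) (a := (N : ℤ)) (b := 1) h1 1
    simpa using this
  have h4 : ¬ (p : ℤ) ^ 2 ∣ (N : ℤ) - (N : ℤ) ^ p := by
    intro h
    apply h2
    apply Nat.ModEq.symm
    rw [Nat.modEq_iff_dvd]
    have := dvd_add h h3
    push_cast
    have e : (N : ℤ) - 1 = (N : ℤ) - (N : ℤ) ^ p + ((N : ℤ) ^ p - 1) := by abel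
    rw [e]
    exact this
  have h5 : (p : ℤ) ∣ (N : ℤ) - (N : ℤ) ^ p := by
    have h6 := dvd_sub h1 (dvd_trans (dvd_pow_self _ two_ne_zero) h3)
    have e : (N : ℤ) - (N : ℤ) ^ p = (N : ℤ) - 1 - ((N : ℤ) ^ p - 1) := by abel
    rw [e]
    exact h6
  obtain ⟨m, hm⟩ := h5
  refine ⟨m, hm, ?_⟩
  rw [(Nat.prime_iff_prime_int.1 hp).coprime_iff_not_dvd]
  rintro ⟨k, rfl⟩
  apply h4
  exact ⟨k, by rw [hm]; ring⟩

theorem case1_root (p N : ℕ) (hp : p.Prime) (hmod : N ≡ 1 [MOD p]) (h2 : ¬ N ≡ 1 [MOD p ^ 2])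
    {L : Type} [Field L] [NumberField L] (a : 𝓞 L) (ha : a ^ p = (N : 𝓞 L)) :
    ∃ D : Ideal (𝓞 L), Ideal.span {(p : 𝓞 L)} = D ^ p := by
  obtain ⟨m, hm, hco⟩ := case1_num p N hp hmod h2
  obtain ⟨r, hr⟩ := exists_add_pow_prime_eq hp (a - N) (N : 𝓞 L)
  rw [sub_add_cancel, ha] at hr
  have hm' : (N : 𝓞 L) - (N : 𝓞 L) ^ p = p * (m : 𝓞 L) := by exact_mod_cast congrArg (Int.cast : ℤ → 𝓞 L) hm
  have hy : (p : 𝓞 L) * (m - (a - N) * N * r) = (a - N) ^ p := by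
    linear_combination (-1 : 𝓞 L) * hm' + hr
  apply ideal_pow_root _ (Ideal.span {(m - (a - N) * N * r : 𝓞 L)}) (Ideal.span {a - (N : 𝓞 L)})
  · rw [Ideal.isCoprime_iff_sup_eq]
    by_contra hne
    obtain ⟨M, hM, hle⟩ := Ideal.exists_le_maximal _ hne
    have e1 : (p : 𝓞 L) ∈ M := hle (Ideal.mem_sup_left (Ideal.mem_span_singleton_self _))
    have e2 : (m - (a - N) * N * r : 𝓞 L) ∈ M := hle (Ideal.mem_sup_right (Ideal.mem_span_singleton_self _))
    have e3 : (a - N : 𝓞 L) ∈ M := by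
      apply hM.isPrime.mem_of_pow_mem p
      rw [← hy]
      exact M.mul_mem_right _ e1
    have e4 : (m : 𝓞 L) ∈ M := by
      have := M.add_mem e2 (M.mul_mem_right (N * r) e3)
      convert this using 1
      ring
    obtain ⟨s, t, hst⟩ := hco
    apply hM.ne_top
    rw [Ideal.eq_top_iff_one]
    have h6 := congrArg (Int.cast : ℤ → 𝓞 L) hst
    push_cast at h6
    rw [← h6]
    exact M.add_mem (M.mul_mem_left _ e1) (M.mul_mem_left _ e4)
  · rw [Ideal.span_singleton_mul_span_singleton, hy, Ideal.span_singleton_pow]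

open IsDedekindDomain in
theorem case1_final (p N : ℕ) (hp : p.Prime) (hpodd : Odd p) (hN : N.Prime) (hNp : N ≠ p)
    (hmod : N ≡ 1 [MOD p]) (hmod2 : ¬ N ≡ 1 [MOD p ^ 2])
    {K L : Type} [Field K] [Field L]
    [NumberField K] [NumberField L] [Algebra K L] [IsCyclotomicExtension {p} ℚ K]
    (hdeg : Module.finrank K L = p) (σ : L ≃ₐ[K] L) (hσp : σ ^ p = 1)
    (hfix : ∀ x : L, σ x = x → ∃ y : K, algebraMap K L y = x) (ζ : K) (hζ : IsPrimitiveRoot ζ p)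
    (α : L) (hα : α ^ p = N) :
    (p - 1) / 2 ≤ pRank p (ClassGroup (𝓞 L)) := by
  have := Fact.mk hp
  have hp2 := hp.two_le
  obtain ⟨ι, hι, v, A, hcard, hv, hA, hmem⟩ := primes_data p N hp hN hNp hmod (algebraMap K L) α hα
  have hinteg : IsIntegral ℤ α := by
    apply IsIntegral.of_pow hp.pos
    rw [hα]
    exact isIntegral_algebraMap_natCast _
  obtain ⟨D, hD⟩ := case1_root p N hp hmod hmod2 (⟨α, hinteg⟩ : 𝓞 L) (RingOfIntegers.ext (by push_cast; exact hα))
  have hassoc := IsCyclotomicExtension.Rat.associated_zeta_sub_one_pow_prime p hζ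
  have hprime := IsCyclotomicExtension.Rat.isPrime_span_zeta_sub_one' p hζ
  set l : 𝓞 K := hζ.toInteger - 1 with hl
  have hl2 : Ideal.span {l} ^ (p - 1) = Ideal.span {(p : 𝓞 K)} := by
    rw [Ideal.span_singleton_pow]
    exact Ideal.span_singleton_eq_span_singleton.2 hassoc
  have hp0 : (p : 𝓞 K) ≠ 0 := by exact_mod_cast hp.ne_zero
  have hlne : Ideal.span {l} ≠ ⊥ := by
    intro h
    rw [h, ← Ideal.zero_eq_bot, zero_pow (by omega)] at hl2
    exact hp0 (Ideal.span_singleton_eq_bot.1 hl2.symm)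
  let w : HeightOneSpectrum (𝓞 K) := ⟨Ideal.span {l}, hprime, hlne⟩
  have hwN : (N : 𝓞 K) ∉ w.asIdeal := by
    intro h
    have hpw : (p : 𝓞 K) ∈ w.asIdeal := by
      have : Ideal.span {l} ^ (p - 1) ≤ Ideal.span {l} := Ideal.pow_le_self (by omega)
      rw [hl2] at this
      exact this (Ideal.mem_span_singleton_self _)
    have hco : IsCoprime (p : ℤ) (N : ℤ) := by
      rw [Nat.isCoprime_iff_coprime]
      exact (Nat.coprime_primes hp hN).2 (Ne.symm hNp)
    obtain ⟨s, t, hst⟩ := hco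
    have h6 := congrArg (Int.cast : ℤ → 𝓞 K) hst
    push_cast at h6
    apply hprime.ne_top
    rw [Ideal.eq_top_iff_one, ← h6]
    exact w.asIdeal.add_mem (w.asIdeal.mul_mem_left _ hpw) (w.asIdeal.mul_mem_left _ h)
  have hpK : (Ideal.span {(p : 𝓞 K)} : Ideal (𝓞 K)) ≠ ⊥ := by
    rw [Ne, Ideal.span_singleton_eq_bot]
    exact hp0
  obtain ⟨U, hU⟩ := root_of_ideal (algebraMap K L) p hp.ne_zero (Ideal.span {(p : 𝓞 K)})
    (FractionalIdeal.coeIdeal_ne_zero.2 hpK) D (by rw [Ideal.map_span, ← hD]; simp)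
  have hwp : prU w ^ (p - 1) = Units.mk0 _ (FractionalIdeal.coeIdeal_ne_zero (K := K) |>.2 hpK) := by
    apply Units.ext
    rw [Units.val_pow_eq_pow_val, prU_val, Units.val_mk0, ← FractionalIdeal.coeIdeal_pow, hl2]
  rw [← hwp, map_pow] at hU
  have hW : (exU (algebraMap K L) (prU w) * U⁻¹) ^ p = exU (algebraMap K L) (prU w) := by
    rw [mul_pow, inv_pow, hU]
    conv_lhs => rw [show p = (p - 1) + 1 by omega]
    rw [pow_succ]
    simp
  refine case1_frame p hp hpodd hdeg σ hσp hfix (ι := Option ι)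
    (by rw [Fintype.card_option, hcard]; omega) (fun o => o.elim w v) ?_
    (fun o => o.elim (exU (algebraMap K L) (prU w) * U⁻¹) A) ?_
  · rintro (_ | i) (_ | j) h
    · rfl
    · exfalso
      simp only [Option.elim_none, Option.elim_some] at h
      apply hwN
      rw [h]
      exact hmem j
    · exfalso
      simp only [Option.elim_none, Option.elim_some] at h
      apply hwN
      rw [← h]
      exact hmem i
    · exact congrArg some (hv h)
  · rintro (_ | i)
    · exact hW
    · exact hA i

section nm
variable {K L : Type} [Field K] [Field L] [NumberField K] [NumberField L] [Algebra K L]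

noncomputable def nmF (p : ℕ) (σ : L ≃ₐ[K] L) (X : FractionalIdeal (𝓞 L)⁰ L) :
    FractionalIdeal (𝓞 L)⁰ L := ∏ j ∈ Finset.range p, ex ((σ ^ j : L ≃ₐ[K] L) : L →+* L) X

theorem nmF_mul (p : ℕ) (σ : L ≃ₐ[K] L) (X Y : FractionalIdeal (𝓞 L)⁰ L) :
    nmF p σ (X * Y) = nmF p σ X * nmF p σ Y := by
  simp only [nmF, map_mul, Finset.prod_mul_distrib]

theorem ex_pow_succ (σ : L ≃ₐ[K] L) (j : ℕ) (X : FractionalIdeal (𝓞 L)⁰ L) :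
    ex (σ : L →+* L) (ex ((σ ^ j : L ≃ₐ[K] L) : L →+* L) X) =
      ex ((σ ^ (j + 1) : L ≃ₐ[K] L) : L →+* L) X := by
  rw [ex_comp]
  congr 2
  rw [pow_succ']
  rfl

theorem prod_shift {M : Type*} [CommMonoid M] (f : ℕ → M) (p : ℕ) (hp : p ≠ 0) (h : f p = f 0) :
    ∏ j ∈ Finset.range p, f (j + 1) = ∏ j ∈ Finset.range p, f j := by
  obtain ⟨q, rfl⟩ := Nat.exists_eq_succ_of_ne_zero hp
  rw [Finset.prod_range_succ, Finset.prod_range_succ', h]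

theorem sum_shift {M : Type*} [AddCommMonoid M] (f : ℕ → M) (p : ℕ) (hp : p ≠ 0) (h : f p = f 0) :
    ∑ j ∈ Finset.range p, f (j + 1) = ∑ j ∈ Finset.range p, f j := by
  obtain ⟨q, rfl⟩ := Nat.exists_eq_succ_of_ne_zero hp
  rw [Finset.sum_range_succ, Finset.sum_range_succ', h]

theorem nmF_inv (p : ℕ) (hp : p ≠ 0) (σ : L ≃ₐ[K] L) (hσp : σ ^ p = 1) (X : FractionalIdeal (𝓞 L)⁰ L) :
    ex (σ : L →+* L) (nmF p σ X) = nmF p σ X := by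
  unfold nmF
  rw [map_prod]
  simp only [ex_pow_succ]
  apply prod_shift (fun j => ex ((σ ^ j : L ≃ₐ[K] L) : L →+* L) X) p hp
  simp only [hσp, pow_zero]

theorem nmF_inv_pow (p : ℕ) (hp : p ≠ 0) (σ : L ≃ₐ[K] L) (hσp : σ ^ p = 1)
    (X : FractionalIdeal (𝓞 L)⁰ L) (j : ℕ) :
    ex ((σ ^ j : L ≃ₐ[K] L) : L →+* L) (nmF p σ X) = nmF p σ X := by
  induction j with
  | zero =>
    rw [pow_zero]
    exact ex_id _
  | succ j ih => rw [← ex_pow_succ, ih, nmF_inv p hp σ hσp]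

theorem spanSingleton_prod_aux (s : Finset ℕ) (f : ℕ → L) :
    ∏ j ∈ s, FractionalIdeal.spanSingleton (𝓞 L)⁰ (f j) =
      FractionalIdeal.spanSingleton (𝓞 L)⁰ (∏ j ∈ s, f j) := by
  classical
  induction s using Finset.induction_on with
  | empty => simp
  | insert a s ha ih =>
    rw [Finset.prod_insert ha, Finset.prod_insert ha, ih, FractionalIdeal.spanSingleton_mul_spanSingleton]

theorem nmF_span (p : ℕ) (σ : L ≃ₐ[K] L) (x : L) :
    nmF p σ (FractionalIdeal.spanSingleton _ x) =
      FractionalIdeal.spanSingleton _ (∏ j ∈ Finset.range p, (σ ^ j) x) := by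
  unfold nmF
  simp only [ex_span]
  rw [spanSingleton_prod_aux]
  rfl

noncomputable def nmI (p : ℕ) (σ : L ≃ₐ[K] L) (X : Ideal (𝓞 L)) : Ideal (𝓞 L) :=
  ∏ j ∈ Finset.range p, X.map (RingOfIntegers.mapRingHom ((σ ^ j : L ≃ₐ[K] L) : L →+* L))

theorem nmI_coe (p : ℕ) (σ : L ≃ₐ[K] L) (X : Ideal (𝓞 L)) :
    ((nmI p σ X : Ideal (𝓞 L)) : FractionalIdeal (𝓞 L)⁰ L) = nmF p σ (X : FractionalIdeal (𝓞 L)⁰ L) := by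
  unfold nmI nmF
  simp only [ex_ideal]
  exact map_prod (FractionalIdeal.coeIdealHom (𝓞 L)⁰ L) _ _

theorem nmI_inv_pow (p : ℕ) (hp : p ≠ 0) (σ : L ≃ₐ[K] L) (hσp : σ ^ p = 1)
    (X : Ideal (𝓞 L)) (j : ℕ) :
    (nmI p σ X).map (RingOfIntegers.mapRingHom ((σ ^ j : L ≃ₐ[K] L) : L →+* L)) = nmI p σ X := by
  apply FractionalIdeal.coeIdeal_injective (K := L)
  beta_reduce
  rw [← ex_ideal, nmI_coe, nmF_inv_pow p hp σ hσp]

theorem nmI_coprime (p : ℕ) (hp : p ≠ 0) (σ : L ≃ₐ[K] L) (hσp : σ ^ p = 1)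
    (X Y : Ideal (𝓞 L)) (h : IsCoprime (nmI p σ X) Y) : IsCoprime (nmI p σ X) (nmI p σ Y) := by
  apply IsCoprime.prod_right
  intro j _
  have := h.map (Ideal.mapHom (RingOfIntegers.mapRingHom ((σ ^ j : L ≃ₐ[K] L) : L →+* L)))
  rw [← nmI_inv_pow p hp σ hσp X j]
  exact this

theorem prod_fixed (p : ℕ) (hp : p ≠ 0) (σ : L ≃ₐ[K] L) (hσp : σ ^ p = 1) (x : L) :
    σ (∏ j ∈ Finset.range p, (σ ^ j) x) = ∏ j ∈ Finset.range p, (σ ^ j) x := by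
  rw [map_prod]
  rw [← prod_shift (fun j => (σ ^ j) x) p hp (by simp [hσp])]
  refine Finset.prod_congr rfl fun j _ => ?_
  rw [pow_succ']
  rfl

theorem nmF_range_ideal (p : ℕ) (hp : p ≠ 0) (σ : L ≃ₐ[K] L) (hσp : σ ^ p = 1)
    (hfix : ∀ x : L, σ x = x → ∃ y : K, algebraMap K L y = x) (I : Ideal (𝓞 L)) (hI : I ≠ ⊥) :
    ∃ B, nmF p σ (I : FractionalIdeal (𝓞 L)⁰ L) = ex (algebraMap K L) B := by
  obtain ⟨x, hx, hx0⟩ := Submodule.exists_mem_ne_zero_of_ne_bot hI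
  obtain ⟨a, ha⟩ := Ideal.dvd_iff_le.2 ((Ideal.span_singleton_le_iff_mem I).2 hx)
  have ha0 : a ≠ ⊥ := by
    rintro rfl
    rw [Ideal.mul_bot, Ideal.span_singleton_eq_bot] at ha
    exact hx0 ha
  have hM0 : nmI p σ a ≠ ⊥ := by
    unfold nmI
    rw [← Ideal.zero_eq_bot, Finset.prod_ne_zero_iff]
    intro j _ h
    have h1 : ex ((σ ^ j : L ≃ₐ[K] L) : L →+* L) (a : FractionalIdeal (𝓞 L)⁰ L) = 0 := by
      rw [ex_ideal, h]
      simp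
    rw [← map_zero (ex ((σ ^ j : L ≃ₐ[K] L) : L →+* L))] at h1
    have h2 := ex_inj _ h1
    exact ha0 (FractionalIdeal.coeIdeal_eq_zero.1 h2)
  obtain ⟨x', hx'⟩ := IsDedekindDomain.exists_sup_span_eq (I := I * nmI p σ a) (J := I) Ideal.mul_le_left
    (mul_ne_zero hI hM0)
  have hxI : x' ∈ I := by
    rw [← hx']
    exact Ideal.mem_sup_right (Ideal.mem_span_singleton_self _)
  obtain ⟨a', ha'⟩ := Ideal.dvd_iff_le.2 ((Ideal.span_singleton_le_iff_mem I).2 hxI)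
  have hco : IsCoprime (nmI p σ a) a' := by
    rw [Ideal.isCoprime_iff_add]
    apply mul_left_cancel₀ (show I ≠ 0 from hI)
    rw [mul_add, ← ha', mul_one]
    exact hx'
  have hco2 := Ideal.isCoprime_iff_add.1 (nmI_coprime p hp σ hσp a a' hco)
  have hco3 := congrArg (fun z : Ideal (𝓞 L) => (z : FractionalIdeal (𝓞 L)⁰ L)) hco2
  simp only [FractionalIdeal.coeIdeal_sup, Submodule.add_eq_sup] at hco3
  rw [nmI_coe, nmI_coe] at hco3
  obtain ⟨y, hy⟩ := hfix _ (prod_fixed p hp σ hσp (x : L))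
  obtain ⟨y', hy'⟩ := hfix _ (prod_fixed p hp σ hσp (x' : L))
  refine ⟨FractionalIdeal.spanSingleton _ y + FractionalIdeal.spanSingleton _ y', ?_⟩
  rw [map_add, ex_span, ex_span, hy, hy', ← nmF_span, ← nmF_span]
  have e1 : FractionalIdeal.spanSingleton (𝓞 L)⁰ (x : L) = (I : FractionalIdeal (𝓞 L)⁰ L) * a := by
    rw [← FractionalIdeal.coeIdeal_mul, ← ha, FractionalIdeal.coeIdeal_span_singleton]
  have e2 : FractionalIdeal.spanSingleton (𝓞 L)⁰ (x' : L) = (I : FractionalIdeal (𝓞 L)⁰ L) * a' := by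
    rw [← FractionalIdeal.coeIdeal_mul, ← ha', FractionalIdeal.coeIdeal_span_singleton]
  rw [e1, e2, nmF_mul, nmF_mul, ← mul_add]
  erw [hco3]
  simp

theorem nmF_range (p : ℕ) (hp : p ≠ 0) (σ : L ≃ₐ[K] L) (hσp : σ ^ p = 1)
    (hfix : ∀ x : L, σ x = x → ∃ y : K, algebraMap K L y = x) (J : (FractionalIdeal (𝓞 L)⁰ L)ˣ) :
    ∏ j ∈ Finset.range p, exU ((σ ^ j : L ≃ₐ[K] L) : L →+* L) J ∈ (exU (algebraMap K L)).range := by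
  obtain ⟨d, I, hd, hI⟩ := FractionalIdeal.exists_eq_spanSingleton_mul (J : FractionalIdeal (𝓞 L)⁰ L)
  have hI0 : I ≠ ⊥ := by
    rintro rfl
    apply Units.ne_zero J
    rw [hI]
    simp
  obtain ⟨B, hB⟩ := nmF_range_ideal p hp σ hσp hfix I hI0
  obtain ⟨y, hy⟩ := hfix _ (prod_fixed p hp σ hσp ((algebraMap (𝓞 L) L d)⁻¹ : L))
  have h1 : ((∏ j ∈ Finset.range p, exU ((σ ^ j : L ≃ₐ[K] L) : L →+* L) J :
      (FractionalIdeal (𝓞 L)⁰ L)ˣ) : FractionalIdeal (𝓞 L)⁰ L) =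
      ex (algebraMap K L) (FractionalIdeal.spanSingleton _ y * B) := by
    rw [Units.coe_prod, map_mul, ex_span, hy, ← nmF_span, ← hB, ← nmF_mul, ← hI]
    rfl
  have h2 : FractionalIdeal.spanSingleton _ y * B ≠ 0 := by
    intro h
    rw [h, map_zero] at h1
    exact Units.ne_zero _ h1
  refine ⟨Units.mk0 _ h2, ?_⟩
  apply Units.ext
  rw [exU_val, Units.val_mk0, h1]
end nm

theorem case2_J (p : ℕ) (hp : p ≠ 0) {K L : Type} [Field K] [Field L]
    [NumberField K] [NumberField L] [Algebra K L] (σ : L ≃ₐ[K] L) (c : Lˣ) (η : L)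
    (hη : η ^ p = 1) (hc : ∏ j ∈ Finset.range p, (σ ^ j) (c : L) = η) :
    ∃ J : (FractionalIdeal (𝓞 L)⁰ L)ˣ,
      toPrincipalIdeal (𝓞 L) L c * exU (σ : L →+* L) J = J := by
  let b : ℕ → L := fun n => ∏ j ∈ Finset.range n, (σ ^ j) (c : L)
  have hb : ∀ n, (c : L) * σ (b n) = b (n + 1) := by
    intro n
    simp only [b]
    rw [Finset.prod_range_succ', map_prod, mul_comm]
    congr 1
    refine Finset.prod_congr rfl fun j _ => ?_
    rw [pow_succ']
    rfl
  have hb0 : b 0 = 1 := by simp [b]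
  let J0 : FractionalIdeal (𝓞 L)⁰ L := ∑ j ∈ Finset.range p, FractionalIdeal.spanSingleton (𝓞 L)⁰ (b j)
  have hη1 : FractionalIdeal.spanSingleton (𝓞 L)⁰ η = 1 := by
    have h1 : IsIntegral ℤ η := by
      apply IsIntegral.of_pow (Nat.pos_of_ne_zero hp)
      rw [hη]
      exact isIntegral_one
    let e : 𝓞 L := ⟨η, h1⟩
    have he : e ^ p = 1 := RingOfIntegers.ext (by push_cast; exact hη)
    have hu : IsUnit e := IsUnit.of_pow_eq_one he hp
    have : FractionalIdeal.spanSingleton (𝓞 L)⁰ η = ((Ideal.span {e} : Ideal (𝓞 L)) : FractionalIdeal (𝓞 L)⁰ L) := by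
      rw [FractionalIdeal.coeIdeal_span_singleton]
      rfl
    rw [this, Ideal.span_singleton_eq_top.2 hu]
    simp
  have hJ0 : J0 ≠ 0 := by
    have h1 : (1 : FractionalIdeal (𝓞 L)⁰ L) ≤ J0 := by
      have := Finset.single_le_sum (f := fun j => FractionalIdeal.spanSingleton (𝓞 L)⁰ (b j))
        (s := Finset.range p) (fun i _ => zero_le) (Finset.mem_range.2 (Nat.pos_of_ne_zero hp))
      simpa [hb0] using this
    intro h
    rw [h] at h1
    exact one_ne_zero (le_antisymm h1 (zero_le))
  refine ⟨Units.mk0 J0 hJ0, ?_⟩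
  apply Units.ext
  rw [Units.val_mul, exU_val, coe_toPrincipalIdeal, Units.val_mk0]
  simp only [J0]
  rw [map_sum, Finset.mul_sum]
  simp only [ex_span, FractionalIdeal.spanSingleton_mul_spanSingleton]
  rw [← sum_shift (fun j => FractionalIdeal.spanSingleton (𝓞 L)⁰ (b j)) p hp]
  · refine Finset.sum_congr rfl fun j _ => ?_
    rw [← hb j]
    rfl
  · simp only [hb0]
    simp only [b]
    rw [hc, hη1]
    simp

theorem case2_Jp (p : ℕ) (hp : p ≠ 0) {K L : Type} [Field K] [Field L]
    [NumberField K] [NumberField L] [Algebra K L] (σ : L ≃ₐ[K] L) (hσp : σ ^ p = 1)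
    (hfix : ∀ x : L, σ x = x → ∃ y : K, algebraMap K L y = x)
    (J : (FractionalIdeal (𝓞 L)⁰ L)ˣ) (c : Lˣ)
    (hJ : exU (σ : L →+* L) J = toPrincipalIdeal (𝓞 L) L c * J) :
    ∃ y, ∃ b ∈ (exU (algebraMap K L)).range, J ^ p = toPrincipalIdeal (𝓞 L) L y * b := by
  have h1 : ∀ j : ℕ, ∃ y, exU ((σ ^ j : L ≃ₐ[K] L) : L →+* L) J = toPrincipalIdeal (𝓞 L) L y * J := by
    intro j
    induction j with
    | zero =>
      refine ⟨1, ?_⟩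
      rw [map_one, one_mul, pow_zero]
      exact exU_id J
    | succ j ih =>
      obtain ⟨y, hy⟩ := ih
      have h2 : exU ((σ ^ (j + 1) : L ≃ₐ[K] L) : L →+* L) J =
          exU (σ : L →+* L) (exU ((σ ^ j : L ≃ₐ[K] L) : L →+* L) J) := by
        apply Units.ext
        rw [exU_val, exU_val, exU_val, ex_pow_succ]
      rw [h2, hy, map_mul, exU_div, hJ]
      refine ⟨Units.map ((σ : L →+* L) : L →* L) y * c, ?_⟩
      rw [map_mul, mul_assoc]
  choose y hy using h1
  refine ⟨(∏ j ∈ Finset.range p, y j)⁻¹, _, nmF_range p hp σ hσp hfix J, ?_⟩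
  simp only [hy]
  rw [Finset.prod_mul_distrib, Finset.prod_const, Finset.card_range, ← map_prod, ← mul_assoc, ← map_mul,
    inv_mul_cancel, map_one, one_mul]

theorem case2_of_norm (p N : ℕ) (hp : p.Prime) (hpodd : Odd p) (hN : N.Prime) (hNp : N ≠ p)
    (hmod : N ≡ 1 [MOD p])
    {K L : Type} [Field K] [Field L]
    [NumberField K] [NumberField L] [Algebra K L] [IsCyclotomicExtension {p} ℚ K]
    (hdeg : Module.finrank K L = p) (σ : L ≃ₐ[K] L) (hσp : σ ^ p = 1)
    (hfix : ∀ x : L, σ x = x → ∃ y : K, algebraMap K L y = x)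
    (α : L) (hα : α ^ p = N) (c : L) (η : L) (hη : η ^ p = 1) (hη1 : η ≠ 1)
    (hc : ∏ j ∈ Finset.range p, (σ ^ j) c = η) :
    (p - 1) / 2 ≤ pRank p (ClassGroup (𝓞 L)) := by
  have hc0 : c ≠ 0 := by
    rintro rfl
    simp only [map_zero, Finset.prod_const, Finset.card_range, zero_pow hp.ne_zero] at hc
    rw [← hc, zero_pow hp.ne_zero] at hη
    exact zero_ne_one hη
  obtain ⟨ι, hι, v, A, hcard, hv, hA, -⟩ := primes_data p N hp hN hNp hmod (algebraMap K L) α hα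
  obtain ⟨J, hJ⟩ := case2_J p hp.ne_zero σ (Units.mk0 c hc0) η hη hc
  have hJ' : exU (σ : L →+* L) J = toPrincipalIdeal (𝓞 L) L (Units.mk0 c hc0)⁻¹ * J := by
    rw [map_inv, eq_inv_mul_iff_mul_eq, hJ]
  refine case2_frame p hp hpodd hdeg σ hσp hfix hcard v hv A hA J (Units.mk0 c hc0)⁻¹ hJ' η⁻¹ ?_ ?_ ?_
    (case2_Jp p hp.ne_zero σ hσp hfix J _ hJ')
  · rw [inv_pow, hη, inv_one]
  · intro h
    exact hη1 (inv_eq_one.1 h)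
  · rw [← hc, ← Finset.prod_inv_distrib]
    refine Finset.prod_congr rfl fun j _ => ?_
    rw [Units.val_inv_eq_inv_val, map_inv₀, Units.val_mk0]

theorem prod_gal_pow {L Ω : Type} [Field L] [Field Ω] [Algebra L Ω] [FiniteDimensional L Ω]
    [IsGalois L Ω] (s : Ω ≃ₐ[L] Ω) (hgen : ∀ g, g ∈ Subgroup.zpowers s) (p : ℕ)
    (hfr : Module.finrank L Ω = p) (x : Ω) :
    algebraMap L Ω (Algebra.norm L x) = ∏ j ∈ Finset.range p, (s ^ j) x := by
  classical
  rw [Algebra.norm_eq_prod_automorphisms]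
  have ho : orderOf s = p := by
    rw [orderOf_eq_card_of_forall_mem_zpowers hgen, ← hfr, IsGalois.card_aut_eq_finrank]
  symm
  refine Finset.prod_bij (fun j _ => s ^ j) (fun _ _ => Finset.mem_univ _) ?_ ?_ (fun _ _ => rfl)
  · intro a ha b hb hab
    apply pow_injOn_Iio_orderOf (x := s) _ _ hab
    · rw [ho]; simpa using ha
    · rw [ho]; simpa using hb
  · intro g _
    have hg := hgen g
    rw [← mem_powers_iff_mem_zpowers] at hg
    obtain ⟨j, hj⟩ := hg
    refine ⟨j % p, ?_, ?_⟩
    · have : 0 < p := by rw [← hfr]; exact Module.finrank_pos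
      simpa using Nat.mod_lt _ this
    · rw [← ho, pow_mod_orderOf]; exact hj

theorem h90_core {L Ω : Type} [Field L] [Field Ω] [Algebra L Ω] [FiniteDimensional L Ω]
    [IsGalois L Ω] (p : ℕ) (hfr : Module.finrank L Ω = p) (s : Ω ≃ₐ[L] Ω)
    (hgen : ∀ g, g ∈ Subgroup.zpowers s)
    (hfix : ∀ x, s x = x → ∃ y, algebraMap L Ω y = x)
    (σ : L ≃+* L) (τ : Ω ≃+* Ω) (hτσ : ∀ x, τ (algebraMap L Ω x) = algebraMap L Ω (σ x))
    (hτp : τ ^ p = 1)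
    (A B : Ω) (z : L) (hA0 : A ≠ 0) (hB0 : B ≠ 0) (hsA : s A = algebraMap L Ω z * A)
    (hAp : A ^ p = algebraMap L Ω z) (hτA : τ A = A) (hsB : s B = B)
    (hτB : τ B = algebraMap L Ω z * B)
    (hcomm : ∀ x, τ (s x) = s (τ x)) (y : Ω) (hτy : τ y = y) (k : ℕ)
    (hy : ∏ j ∈ Finset.range p, (s ^ j) y = (B ^ p) ^ k) :
    ∃ c : L, ∏ j ∈ Finset.range p, (σ ^ j) c = (z ^ k)⁻¹ := by
  have hsjB : ∀ j : ℕ, (s ^ j) B = B := by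
    intro j
    induction j with
    | zero => simp
    | succ j ih => rw [pow_succ, AlgEquiv.mul_apply, hsB, ih]
  have hnorm : Algebra.norm L (y / B ^ k) = 1 := by
    apply (algebraMap L Ω).injective
    rw [prod_gal_pow s hgen p hfr, map_one]
    simp only [_root_.map_div₀, map_pow, hsjB]
    rw [Finset.prod_div_distrib, hy, Finset.prod_const, Finset.card_range, ← pow_mul, ← pow_mul,
      mul_comm, div_self]
    exact pow_ne_zero _ hB0
  haveI : IsCyclic (Ω ≃ₐ[L] Ω) := ⟨s, hgen⟩
  obtain ⟨u, hu⟩ := groupCohomology.exists_div_of_norm_eq_one hgen hnorm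
  have hu0 : (u : Ω) ≠ 0 := u.ne_zero
  have hsu0 : s (u : Ω) ≠ 0 := by simpa using hu0
  have hz0 : algebraMap L Ω z ≠ 0 := by rw [← hAp]; exact pow_ne_zero _ hA0
  have hτu0 : τ (u : Ω) ≠ 0 := by simpa using hu0
  have hsτu0 : s (τ (u : Ω)) ≠ 0 := by simpa using hu0
  have hy1 : y * s (u : Ω) = B ^ k * u := by
    have := hu
    field_simp at this
    rw [eq_comm, mul_comm]
    linear_combination this
  have hy2 : y * s (τ (u : Ω)) = (algebraMap L Ω z) ^ k * B ^ k * τ u := by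
    have := congrArg τ hy1
    rw [map_mul, map_mul, map_pow, hτy, hτB, hcomm] at this
    rw [this]; ring
  have hy0 : y ≠ 0 := by
    rintro rfl
    rw [zero_mul] at hy1
    exact mul_ne_zero (pow_ne_zero _ hB0) hu0 hy1.symm
  set w : Ω := u / τ u with hw
  have hw0 : w ≠ 0 := div_ne_zero hu0 hτu0
  have hsw : s w * algebraMap L Ω z ^ k = w := by
    rw [hw, _root_.map_div₀]
    field_simp
    have hBk : B ^ k ≠ 0 := pow_ne_zero _ hB0
    apply mul_left_cancel₀ (mul_ne_zero hBk hy0)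
    linear_combination (algebraMap L Ω z ^ k * B ^ k * τ u) * hy1 - (B ^ k * u) * hy2
  obtain ⟨c, hc⟩ := hfix (w * A ^ k) (by
    rw [map_mul, map_pow, hsA, mul_pow, ← mul_assoc, hsw])
  have hτjA : ∀ j : ℕ, (τ ^ j) A = A := by
    intro j
    induction j with
    | zero => simp
    | succ j ih => rw [pow_succ, RingAut.mul_apply, hτA, ih]
  have hτjc : ∀ (j : ℕ) (x : L), (τ ^ j) (algebraMap L Ω x) = algebraMap L Ω ((σ ^ j) x) := by
    intro j
    induction j with
    | zero => simp
    | succ j ih => intro x; rw [pow_succ, RingAut.mul_apply, hτσ, ih, pow_succ, RingAut.mul_apply]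
  have hprodw : ∏ j ∈ Finset.range p, (τ ^ j) w = 1 := by
    have h1 : ∀ j, (τ ^ j) w = (τ ^ j) (u : Ω) / (τ ^ (j + 1)) (u : Ω) := by
      intro j
      rw [hw, _root_.map_div₀, pow_succ, RingAut.mul_apply]
    simp only [h1]
    have hp0 : p ≠ 0 := by rw [← hfr]; exact Module.finrank_pos.ne'
    rw [Finset.prod_div_distrib, prod_shift (fun j => (τ ^ j) (u : Ω)) p hp0 (by
      beta_reduce; rw [hτp, pow_zero]), div_self]
    refine Finset.prod_ne_zero_iff.mpr fun j _ => ?_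
    exact (map_ne_zero_iff _ (τ ^ j).injective).mpr hu0
  refine ⟨c⁻¹, ?_⟩
  apply (algebraMap L Ω).injective
  rw [map_prod]
  simp only [map_inv₀]
  rw [Finset.prod_inv_distrib]
  congr 1
  simp only [← hτjc, hc, map_mul, map_pow, hτjA]
  rw [Finset.prod_mul_distrib, hprodw, one_mul, Finset.prod_const, Finset.card_range, ← hAp]
  ring

theorem not_pow_in_L (p N : ℕ) (hp : p.Prime) (hN : N.Prime) (hNp : N ≠ p)
    {K L : Type} [Field K] [Field L] [NumberField K] [NumberField L] [Algebra K L]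
    [IsCyclotomicExtension {p} ℚ K] (hdeg : Module.finrank K L = p)
    (ζ : L) (hζ : IsPrimitiveRoot ζ p) (α : L) (hα : α ^ p = N) (b : L) : b ^ p ≠ ζ := by
  intro hb
  haveI : NeZero p := ⟨hp.ne_zero⟩
  haveI : NeZero (p ^ 2) := ⟨pow_ne_zero _ hp.ne_zero⟩
  haveI : Fact p.Prime := ⟨hp⟩
  haveI : Fact N.Prime := ⟨hN⟩
  have hbp : IsPrimitiveRoot b (p ^ 2) := by
    have h1 : b ^ (p ^ 1) ≠ 1 := by
      rw [pow_one, hb]; exact hζ.ne_one hp.one_lt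
    have h2 : b ^ (p ^ (1 + 1)) = 1 := by
      rw [show p ^ (1 + 1) = p * p by ring, pow_mul, hb, hζ.pow_eq_one]
    have := orderOf_eq_prime_pow h1 h2
    rw [show p ^ 2 = p ^ (1 + 1) by ring, ← this]
    exact IsPrimitiveRoot.orderOf b
  haveI hc : IsCyclotomicExtension {p ^ 2} ℚ (IntermediateField.adjoin ℚ {b}) :=
    hbp.intermediateField_adjoin_isCyclotomicExtension ℚ
  have hfr : Module.finrank ℚ (IntermediateField.adjoin ℚ {b}) = (p ^ 2).totient :=
    IsCyclotomicExtension.Rat.finrank (p ^ 2) _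
  have hfK : Module.finrank ℚ K = p.totient := IsCyclotomicExtension.Rat.finrank p _
  have hfL : Module.finrank ℚ L = (p ^ 2).totient := by
    rw [← Module.finrank_mul_finrank ℚ K L, hfK, hdeg, Nat.totient_prime hp,
      Nat.totient_prime_pow hp (by norm_num)]
    ring
  have htop : IntermediateField.adjoin ℚ {b} = ⊤ := by
    apply IntermediateField.eq_of_le_of_finrank_eq le_top
    rw [hfr, IntermediateField.finrank_top', hfL]
  have hαm : α ∈ IntermediateField.adjoin ℚ {b} := by rw [htop]; trivial
  apply not_pow_cyc N (p ^ 2) p hp (IntermediateField.adjoin ℚ {b}) (fun h => hNp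
    ((Nat.prime_dvd_prime_iff_eq hN hp).mp (hN.dvd_of_dvd_pow h))) ⟨α, hαm⟩
  apply Subtype.ext
  push_cast
  exact hα

theorem case2_field (p N : ℕ) (hp : p.Prime) (hpodd : Odd p) (hN : N.Prime) (hNp : N ≠ p)
    (hmod : N ≡ 1 [MOD p])
    (Hy : ∀ (F : Type) [Field F] [NumberField F] [IsCyclotomicExtension {p ^ 2} ℚ F] (A : F),
      IsPrimitiveRoot A (p ^ 2) → ∃ (s : F ≃ₐ[ℚ] F) (y : F) (k : ℕ), s A = A ^ (p + 1) ∧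
        ¬ p ∣ k ∧ ∏ j ∈ Finset.range p, (s ^ j) y = (N : F) ^ k)
    {K L : Type} [Field K] [Field L] [NumberField K] [NumberField L] [Algebra K L]
    [IsCyclotomicExtension {p} ℚ K] (hdeg : Module.finrank K L = p) (σ : L ≃ₐ[K] L)
    (hσp : σ ^ p = 1) (hfix : ∀ x : L, σ x = x → ∃ y : K, algebraMap K L y = x)
    (ζ : K) (hζ : IsPrimitiveRoot ζ p) (α : L) (hα : α ^ p = N)
    (hσα : σ α = algebraMap K L ζ * α)
    (hLgen : Algebra.adjoin ℚ {algebraMap K L ζ, α} = (⊤ : Subalgebra ℚ L))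
    (Ω : Type) [Field Ω] [Algebra L Ω] [CharZero Ω] [IsCyclotomicExtension {p ^ 2} L Ω] :
    (p - 1) / 2 ≤ pRank p (ClassGroup (𝓞 L)) := by
  haveI : NeZero p := ⟨hp.ne_zero⟩
  haveI : NeZero (p ^ 2) := ⟨pow_ne_zero _ hp.ne_zero⟩
  haveI : Fact p.Prime := ⟨hp⟩
  haveI : Fact N.Prime := ⟨hN⟩
  have hNp2 : ¬ N ∣ p ^ 2 := fun h => hNp
    ((Nat.prime_dvd_prime_iff_eq hN hp).mp (hN.dvd_of_dvd_pow h))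
  set ζL : L := algebraMap K L ζ with hζL
  have hζL' : IsPrimitiveRoot ζL p := hζ.map_of_injective (algebraMap K L).injective
  have hζΩ : IsPrimitiveRoot (algebraMap L Ω ζL) p :=
    hζL'.map_of_injective (algebraMap L Ω).injective
  haveI : FiniteDimensional L Ω := IsCyclotomicExtension.finiteDimensional {p ^ 2} L Ω
  haveI : FiniteDimensional ℚ Ω := FiniteDimensional.trans ℚ L Ω
  haveI : NumberField Ω := ⟨⟩
  -- choose A
  obtain ⟨A, hA, hAp⟩ : ∃ A : Ω, IsPrimitiveRoot A (p ^ 2) ∧ A ^ p = algebraMap L Ω ζL := by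
    have h0 := IsCyclotomicExtension.zeta_spec (p ^ 2) L Ω
    set A0 := IsCyclotomicExtension.zeta (p ^ 2) L Ω
    have h1 : IsPrimitiveRoot (A0 ^ p) p := h0.pow (pow_pos hp.pos 2) (by ring)
    obtain ⟨j, -, hj⟩ := h1.eq_pow_of_pow_eq_one hζΩ.pow_eq_one
    refine ⟨A0 ^ j, h0.pow_of_coprime j ?_, by rw [← hj, ← pow_mul, ← pow_mul, mul_comm]⟩
    apply Nat.Coprime.pow_right
    apply Nat.Coprime.symm
    rw [hp.coprime_iff_not_dvd]
    rintro ⟨m, rfl⟩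
    rw [pow_mul, h1.pow_eq_one, one_pow] at hj
    exact hζΩ.ne_one hp.one_lt hj.symm
  -- s
  have htopA : Algebra.adjoin L {A} = ⊤ := IsCyclotomicExtension.adjoin_primitive_root_eq_top hA
  have htopA' : IntermediateField.adjoin L {A} = ⊤ := by
    rw [← IntermediateField.toSubalgebra_inj,
      IntermediateField.adjoin_simple_toSubalgebra_of_isAlgebraic (Algebra.IsAlgebraic.isAlgebraic A),
      htopA, IntermediateField.top_toSubalgebra]
  obtain ⟨hfr, hgal, s, hsA, hsp, hsfix, hsgen⟩ := kummer_setup p hp ζL hζL' ζL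
    (not_pow_in_L p N hp hN hNp hdeg ζL hζL' α hα) A hAp htopA'
  -- F
  haveI hF : IsCyclotomicExtension {p ^ 2} ℚ (IntermediateField.adjoin ℚ {A}) :=
    hA.intermediateField_adjoin_isCyclotomicExtension ℚ
  set F := IntermediateField.adjoin ℚ {A} with hFdef
  have hAF : A ∈ F := IntermediateField.mem_adjoin_simple_self ℚ A
  set AF : F := ⟨A, hAF⟩ with hAFdef
  have hAFp : IsPrimitiveRoot AF (p ^ 2) := by
    apply IsPrimitiveRoot.of_map_of_injective (f := algebraMap F Ω) _ (algebraMap F Ω).injective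
    exact hA
  set B : Ω := algebraMap L Ω α with hB
  have hBp : B ^ p = (N : Ω) := by rw [hB, ← map_pow, hα, map_natCast]
  -- ℚ-algebra homs out of Ω
  have hLhom : ∀ (f g : L →+* Ω), f ζL = g ζL → f α = g α → f = g := by
    intro f g h1 h2
    have : f.toRatAlgHom = g.toRatAlgHom := by
      apply AlgHom.ext_of_adjoin_eq_top hLgen
      rintro x (rfl | rfl)
      · exact h1
      · exact h2
    ext x
    exact DFunLike.congr_fun this x
  have hΩhom : ∀ (f g : Ω →+* Ω), f A = g A → f B = g B → f = g := by
    intro f g h1 h2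
    have h3 : f.comp (algebraMap L Ω) = g.comp (algebraMap L Ω) := by
      apply hLhom
      · change f (algebraMap L Ω ζL) = g (algebraMap L Ω ζL)
        rw [← hAp, map_pow, map_pow, h1]
      · exact h2
    ext x
    have hx : x ∈ Algebra.adjoin L {A} := by rw [htopA]; trivial
    induction hx using Algebra.adjoin_induction with
    | mem x hx => rw [Set.mem_singleton_iff.mp hx]; exact h1
    | algebraMap r => exact RingHom.congr_fun h3 r
    | add x y _ _ hx hy => rw [map_add, map_add, hx, hy]
    | mul x y _ _ hx hy => rw [map_mul, map_mul, hx, hy]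
  have htopB : IntermediateField.adjoin F {B} = ⊤ := by
    set E := IntermediateField.adjoin F {B} with hE
    have hBE : B ∈ E := IntermediateField.mem_adjoin_simple_self F B
    have hAE : A ∈ E := IntermediateField.algebraMap_mem E AF
    have hLE : ∀ x : L, algebraMap L Ω x ∈ E := by
      intro x
      have hx : x ∈ Algebra.adjoin ℚ {ζL, α} := by rw [hLgen]; trivial
      induction hx using Algebra.adjoin_induction with
      | mem x hx =>
        rcases hx with rfl | rfl
        · rw [← hAp]; exact pow_mem hAE p
        · exact hBE
      | algebraMap r =>
        rw [eq_ratCast, map_ratCast]; exact SubfieldClass.ratCast_mem E r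
      | add x y _ _ hx hy => rw [map_add]; exact add_mem hx hy
      | mul x y _ _ hx hy => rw [map_mul]; exact mul_mem hx hy
    rw [eq_top_iff]
    intro x _
    have hx : x ∈ Algebra.adjoin L {A} := by rw [htopA]; trivial
    induction hx using Algebra.adjoin_induction with
    | mem x hx => rw [Set.mem_singleton_iff.mp hx]; exact hAE
    | algebraMap r => exact hLE r
    | add x y _ _ hx hy => exact add_mem (hx trivial) (hy trivial)
    | mul x y _ _ hx hy => exact mul_mem (hx trivial) (hy trivial)
  have hζF : IsPrimitiveRoot (AF ^ p) p := hAFp.pow (pow_pos hp.pos 2) (by ring)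
  haveI : FiniteDimensional F Ω := FiniteDimensional.right ℚ F Ω
  obtain ⟨-, -, τ, hτB, hτp, -, -⟩ := kummer_setup p hp (AF ^ p) hζF (N : F)
    (not_pow_cyc N (p ^ 2) p hp F hNp2) B (by rw [hBp, map_natCast]) htopB
  have hAFA : algebraMap F Ω AF = A := rfl
  have hτA : τ A = A := τ.commutes AF
  have hτB' : τ B = algebraMap L Ω ζL * B := by
    rw [hτB, map_pow, hAFA, hAp]
  have hsB : s B = B := s.commutes α
  have hA0 : A ≠ 0 := hA.ne_zero (NeZero.ne _)
  have hB0 : B ≠ 0 := by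
    intro h
    rw [h, zero_pow hp.ne_zero] at hBp
    exact hN.ne_zero (by exact_mod_cast hBp.symm)
  obtain ⟨sF, y, k, hsF, hk, hy⟩ := Hy F AF hAFp
  have hsFs : ∀ x : F, algebraMap F Ω (sF x) = s (algebraMap F Ω x) := by
    intro x
    have hA1 : s A = A ^ (p + 1) := by rw [hsA, ← hAp, pow_succ]
    have key : ((algebraMap F Ω).comp (sF : F →+* F)).toRatAlgHom =
        (((s : Ω ≃+* Ω) : Ω →+* Ω).comp (algebraMap F Ω)).toRatAlgHom := by
      apply AlgHom.ext_of_adjoin_eq_top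
        (IsCyclotomicExtension.adjoin_primitive_root_eq_top (A := ℚ) hAFp)
      rintro x hx
      rw [Set.mem_singleton_iff.mp hx]
      change algebraMap F Ω (sF AF) = s (algebraMap F Ω AF)
      rw [hsF, map_pow, hAFA, hA1]
    exact DFunLike.congr_fun key x
  have hsFsj : ∀ (j : ℕ) (x : F), algebraMap F Ω ((sF ^ j) x) = (s ^ j) (algebraMap F Ω x) := by
    intro j
    induction j with
    | zero => intro x; simp
    | succ j ih =>
      intro x
      rw [pow_succ, AlgEquiv.mul_apply, ih, hsFs, pow_succ, AlgEquiv.mul_apply]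
  have hτσ : ∀ x, (τ : Ω ≃+* Ω) (algebraMap L Ω x) = algebraMap L Ω ((σ : L ≃+* L) x) := by
    have key : ((τ : Ω ≃+* Ω) : Ω →+* Ω).comp (algebraMap L Ω) =
        (algebraMap L Ω).comp ((σ : L ≃+* L) : L →+* L) := by
      apply hLhom
      · change τ (algebraMap L Ω ζL) = algebraMap L Ω (σ ζL)
        rw [hζL, σ.commutes, ← hζL, ← hAp, map_pow, hτA]
      · change τ B = algebraMap L Ω (σ α)
        rw [hτB', hσα, map_mul]
    exact fun x => RingHom.congr_fun key x
  have hcomm : ∀ x, (τ : Ω ≃+* Ω) (s x) = s ((τ : Ω ≃+* Ω) x) := by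
    have hτζ : τ (algebraMap L Ω ζL) = algebraMap L Ω ζL := by rw [← hAp, map_pow, hτA]
    have key : ((τ : Ω ≃+* Ω) : Ω →+* Ω).comp ((s : Ω ≃+* Ω) : Ω →+* Ω) =
        ((s : Ω ≃+* Ω) : Ω →+* Ω).comp ((τ : Ω ≃+* Ω) : Ω →+* Ω) := by
      apply hΩhom
      · change τ (s A) = s (τ A)
        rw [hτA, hsA, map_mul, hτζ, hτA]
      · change τ (s B) = s (τ B)
        rw [hsB, hτB', map_mul, s.commutes, hsB]
    exact fun x => RingHom.congr_fun key x
  have hτp' : (τ : Ω ≃+* Ω) ^ p = 1 := by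
    have h1 : ∀ (j : ℕ) x, ((τ : Ω ≃+* Ω) ^ j) x = (τ ^ j) x := by
      intro j
      induction j with
      | zero => intro x; rfl
      | succ j ih => intro x; rw [pow_succ, RingAut.mul_apply, ih, pow_succ, AlgEquiv.mul_apply]; rfl
    ext x
    rw [h1, hτp]; rfl
  obtain ⟨c, hc⟩ := h90_core p hfr s hsgen hsfix (σ : L ≃+* L) (τ : Ω ≃+* Ω) hτσ hτp' A B ζL hA0 hB0
    hsA hAp hτA hsB hτB' hcomm (algebraMap F Ω y) (τ.commutes y) k (by
      rw [hBp]
      simp only [← hsFsj]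
      rw [← map_prod, hy, map_pow, map_natCast])
  refine case2_of_norm p N hp hpodd hN hNp hmod hdeg σ hσp hfix α hα c (ζL ^ k)⁻¹ ?_ ?_ ?_
  · rw [inv_pow, ← pow_mul, mul_comm, pow_mul, hζL'.pow_eq_one, one_pow, inv_one]
  · intro h
    rw [inv_eq_one] at h
    exact hk (hζL'.dvd_of_pow_eq_one k h)
  · rw [← hc]
    refine Finset.prod_congr rfl fun j _ => ?_
    have h1 : ∀ (j : ℕ) x, ((σ : L ≃+* L) ^ j) x = (σ ^ j) x := by
      intro j
      induction j with
      | zero => intro x; rfl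
      | succ j ih => intro x; rw [pow_succ, RingAut.mul_apply, ih, pow_succ, AlgEquiv.mul_apply]; rfl
    rw [h1]

open scoped Pointwise

theorem exists_fixed_add {C : Type*} [AddCommGroup C] (p : ℕ) (hp : p.Prime) (hpodd : Odd p)
    (f : AddMonoid.End C) (hf : f ^ p = 1) (Q : AddSubgroup C) (hQ : ∀ x ∈ Q, f x ∈ Q)
    (c : C) (hcQ : c ∈ Q) (hc : p • c = 0) (hc0 : c ≠ 0) :
    ∃ e ∈ Q, e ≠ 0 ∧ f e = e ∧ p • e = 0 := by
  classical
  have mul_ap : ∀ (a b : AddMonoid.End C) (x : C), (a * b) x = a (b x) := fun _ _ _ => rfl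
  obtain ⟨r, hr⟩ := ((Commute.one_right f).neg_right).exists_add_pow_prime_eq hp
  have hT : ((f + -1) ^ p) c = 0 := by
    have h1 : (f + -1 : AddMonoid.End C) ^ p = (f * -1 * r) * (p : AddMonoid.End C) := by
      rw [hr, hf, hpodd.neg_one_pow, add_neg_cancel, zero_add]
      rw [mul_assoc (p : AddMonoid.End C), mul_assoc (p : AddMonoid.End C)]
      exact Nat.cast_commute p _
    rw [h1, mul_ap, AddMonoid.End.natCast_apply, hc, map_zero]
  have hex : ∃ n : ℕ, ((f + -1 : AddMonoid.End C) ^ n) c = 0 := ⟨p, hT⟩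
  have hn := Nat.find_spec hex
  have hn0 : Nat.find hex ≠ 0 := by
    intro h
    rw [h, pow_zero] at hn
    exact hc0 hn
  obtain ⟨n, hnn⟩ := Nat.exists_eq_succ_of_ne_zero hn0
  have hlt := Nat.find_min hex (m := n) (by omega)
  rw [hnn, Nat.succ_eq_add_one, pow_succ', mul_ap] at hn
  refine ⟨((f + -1) ^ n) c, ?_, hlt, ?_, ?_⟩
  · clear hn hlt hnn
    induction n with
    | zero => exact hcQ
    | succ n ih =>
      rw [pow_succ', mul_ap]
      exact Q.add_mem (hQ _ ih) (Q.neg_mem ih)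
  · have : f (((f + -1) ^ n) c) + -(((f + -1) ^ n) c) = 0 := hn
    exact eq_of_sub_eq_zero (by rw [sub_eq_add_neg]; exact this)
  · rw [← map_nsmul, hc, map_zero]

theorem absNorm_smul_aux {F : Type} [Field F] [NumberField F] (γ : F ≃ₐ[ℚ] F) (I : Ideal (𝓞 F)) :
    Ideal.absNorm (γ • I) = Ideal.absNorm I := by
  rw [Ideal.absNorm_apply, Ideal.absNorm_apply, Submodule.cardQuot_apply, Submodule.cardQuot_apply]
  symm
  apply Nat.card_congr
  exact (Ideal.quotientEquiv I (γ • I) (MulSemiringAction.toRingEquiv (F ≃ₐ[ℚ] F) (𝓞 F) γ) rfl).toEquiv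

theorem dvd_of_sqfree_aux {R : Type*} [CommRing R] [IsDedekindDomain R] (J I : Ideal R) (hJ0 : J ≠ ⊥)
    (h1 : ∀ P : Ideal R, P.IsPrime → J ≤ P → ∃ Q, J = P * Q ∧ IsCoprime P Q)
    (h2 : ∀ P : Ideal R, P.IsPrime → J ≤ P → I ≤ P) : J ∣ I := by
  obtain ⟨E, hE⟩ : J ⊔ I ∣ J := Ideal.dvd_iff_le.mpr le_sup_left
  have hD0 : J ⊔ I ≠ ⊥ := fun h => hJ0 (le_bot_iff.mp (le_sup_left.trans h.le))
  have hE1 : E = ⊤ := by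
    by_contra hE1
    obtain ⟨P, hPm, hPE⟩ := Ideal.exists_le_maximal E hE1
    have hJE : J ≤ E := by rw [hE]; exact Ideal.mul_le_right
    have hJP := hJE.trans hPE
    obtain ⟨Q, hQ, hcop⟩ := h1 P hPm.isPrime hJP
    have hDP : J ⊔ I ≤ P := sup_le hJP (h2 P hPm.isPrime hJP)
    have hP0 : P ≠ ⊥ := fun h => hJ0 (le_bot_iff.mp (hJP.trans h.le))
    have h3 : P * P ∣ P * Q := by
      rw [← hQ, hE]
      exact mul_dvd_mul (Ideal.dvd_iff_le.mpr hDP) (Ideal.dvd_iff_le.mpr hPE)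
    have h4 : P ∣ Q := (mul_dvd_mul_iff_left hP0).mp h3
    have h5 := Ideal.isCoprime_iff_sup_eq.mp hcop
    rw [sup_eq_left.mpr (Ideal.dvd_iff_le.mp h4)] at h5
    exact hPm.ne_top h5
  rw [hE1, Ideal.mul_top] at hE
  rw [hE]
  exact Ideal.dvd_iff_le.mpr le_sup_right

theorem inv_principal (p : ℕ) (hp : p.Prime) {F : Type} [Field F] [NumberField F]
    [IsCyclotomicExtension {p ^ 2} ℚ F] (n : ℕ) : ∀ (I : Ideal (𝓞 F)), Ideal.absNorm I = n → I ≠ ⊥ →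
    (∀ γ : F ≃ₐ[ℚ] F, γ • I = I) → ∃ x : 𝓞 F, I = Ideal.span {x} := by
  haveI : NeZero p := ⟨hp.ne_zero⟩
  haveI : NeZero (p ^ 2) := ⟨pow_ne_zero _ hp.ne_zero⟩
  haveI : Fact p.Prime := ⟨hp⟩
  haveI hgal : IsGalois ℚ F := IsCyclotomicExtension.isGalois {p ^ 2} ℚ F
  induction n using Nat.strong_induction_on with
  | _ n ih =>
  intro I hIn hI0 hinv
  by_cases hItop : I = ⊤
  · exact ⟨1, by rw [hItop, Ideal.span_singleton_one]⟩
  -- reduction: a principal invariant proper divisor suffices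
  have red : ∀ z : 𝓞 F, Ideal.span {z} ∣ I → Ideal.span {z} ≠ ⊤ →
      (∀ γ : F ≃ₐ[ℚ] F, γ • Ideal.span {z} = Ideal.span {z}) → ∃ x : 𝓞 F, I = Ideal.span {x} := by
    rintro z ⟨I', hI'⟩ hz1 hzinv
    have hz0 : Ideal.span {z} ≠ ⊥ := by
      intro h; rw [h, Ideal.bot_mul] at hI'; exact hI0 hI'
    have hI'0 : I' ≠ ⊥ := by
      intro h; rw [h, Ideal.mul_bot] at hI'; exact hI0 hI'
    have hlt : Ideal.absNorm I' < n := by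
      rw [← hIn, hI', map_mul]
      have h1 : Ideal.absNorm I' ≠ 0 := by rwa [ne_eq, Ideal.absNorm_eq_zero_iff]
      have h2 : Ideal.absNorm (Ideal.span {z}) ≠ 0 := by rwa [ne_eq, Ideal.absNorm_eq_zero_iff]
      have h3 : Ideal.absNorm (Ideal.span {z}) ≠ 1 := by rwa [ne_eq, Ideal.absNorm_eq_one_iff]
      have h4 : 1 < Ideal.absNorm (Ideal.span {z}) := by omega
      nlinarith [Nat.pos_of_ne_zero h1]
    obtain ⟨x, hx⟩ := ih _ hlt I' rfl hI'0 (fun γ => by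
      have h1 := hinv γ
      rw [hI', smul_mul', hzinv] at h1
      exact mul_left_cancel₀ hz0 h1)
    exact ⟨z * x, by rw [hI', hx, Ideal.span_singleton_mul_span_singleton]⟩
  obtain ⟨P, hPm, hIP⟩ := Ideal.exists_le_maximal I hItop
  haveI := hPm.isPrime
  have hP0 : P ≠ ⊥ := fun h => hI0 (le_bot_iff.mp (hIP.trans h.le))
  obtain ⟨q, hq, hqP⟩ : ∃ q : ℕ, q.Prime ∧ P.LiesOver (Ideal.span {(q : ℤ)}) := by
    have h1 : (P.under ℤ) ≠ ⊥ := Ideal.IsIntegral.comap_ne_bot ℤ hP0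
    haveI : (P.under ℤ).IsPrime := inferInstance
    obtain ⟨a, ha⟩ := (IsPrincipalIdealRing.principal (P.under ℤ)).principal
    have ha' : P.under ℤ = Ideal.span {a} := ha
    have ha0 : a ≠ 0 := by
      rintro rfl
      apply h1; rw [ha']; simp
    have hpr : Prime a := by
      rw [← Ideal.span_singleton_prime ha0, ← ha']; infer_instance
    refine ⟨a.natAbs, Int.prime_iff_natAbs_prime.mp hpr, ⟨?_⟩⟩
    rw [Int.span_natAbs, ha']
  haveI : Fact q.Prime := ⟨hq⟩
  have hLO : ∀ Q : Ideal (𝓞 F), Q.IsPrime → Ideal.span {(q : 𝓞 F)} ≤ Q →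
      Q.LiesOver (Ideal.span {(q : ℤ)}) := by
    intro Q hQ hle
    haveI : (Ideal.span {(q : ℤ)}).IsMaximal := Int.ideal_span_isMaximal_of_prime q
    refine ⟨this.eq_of_le (Ideal.IsPrime.under ℤ Q).ne_top ?_⟩
    rw [Ideal.span_singleton_le_iff_mem, Ideal.mem_comap]
    rw [Ideal.span_singleton_le_iff_mem] at hle
    simpa using hle
  by_cases hqp : q = p
  · subst hqp
    have hζ := IsCyclotomicExtension.zeta_spec (q ^ (1 + 1)) ℚ F
    haveI : IsCyclotomicExtension {q ^ (1 + 1)} ℚ F := ‹_›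
    have hPz := IsCyclotomicExtension.Rat.eq_span_zeta_sub_one_of_liesOver q 1 F hζ P
    refine red (hζ.toInteger - 1) ?_ ?_ ?_
    · rw [← hPz]; exact Ideal.dvd_iff_le.mpr hIP
    · rw [← hPz]; exact hPm.ne_top
    · intro γ
      rw [← hPz]
      have hqm : (q : 𝓞 F) ∈ P := by
        have := (Ideal.mem_of_liesOver P (Ideal.span {(q : ℤ)}) (q : ℤ)).mp
          (Ideal.mem_span_singleton_self _)
        simpa using this
      haveI : (γ • P).IsPrime := inferInstance
      haveI := hLO (γ • P) inferInstance (by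
        rw [Ideal.span_singleton_le_iff_mem]
        have h1 := Ideal.smul_mem_pointwise_smul γ _ _ hqm
        have h2 : γ • (q : 𝓞 F) = q := map_natCast (MulSemiringAction.toRingHom (F ≃ₐ[ℚ] F) (𝓞 F) γ) q
        rwa [h2] at h1)
      rw [IsCyclotomicExtension.Rat.eq_span_zeta_sub_one_of_liesOver q 1 F hζ (γ • P)]
      exact hPz.symm
  · have hqm : ¬ q ∣ p ^ 2 := fun h => hqp
      ((Nat.prime_dvd_prime_iff_eq hq hp).mp (hq.dvd_of_dvd_pow h))
    have hqP' : (q : 𝓞 F) ∈ P := by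
      have := (Ideal.mem_of_liesOver P (Ideal.span {(q : ℤ)}) (q : ℤ)).mp
        (Ideal.mem_span_singleton_self _)
      simpa using this
    refine red (q : 𝓞 F) ?_ ?_ ?_
    · apply dvd_of_sqfree_aux
      · rw [ne_eq, Ideal.span_singleton_eq_bot]
        exact_mod_cast hq.ne_zero
      · intro Q hQ hle
        haveI := hLO Q hQ hle
        obtain ⟨Q', h1, h2, -⟩ := unram_cyc q (p ^ 2) F hqm Q
        exact ⟨Q', h1, h2⟩
      · intro Q hQ hle
        haveI := hLO Q hQ hle
        obtain ⟨γ, hγ⟩ := Ideal.exists_smul_eq_of_isGaloisGroup (Ideal.span {(q : ℤ)}) P Q Gal(F/ℚ)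
        rw [← hγ, ← hinv γ]
        exact Ideal.pointwise_smul_le_pointwise_smul_iff.mpr hIP
    · intro h
      apply hPm.ne_top
      rw [eq_top_iff, ← h, Ideal.span_singleton_le_iff_mem]
      exact hqP'
    · intro γ
      have h2 : γ • (q : 𝓞 F) = q := map_natCast (MulSemiringAction.toRingHom (F ≃ₐ[ℚ] F) (𝓞 F) γ) q
      rw [Ideal.pointwise_smul_def, Ideal.map_span, Set.image_singleton]
      congr 2

section
variable {F : Type} [Field F] [NumberField F]

theorem clAct_ker (γ : F ≃ₐ[ℚ] F) : (ClassGroup.mk F : _ →* ClassGroup (𝓞 F)).ker ≤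
    ((ClassGroup.mk F).comp (exU (γ : F →+* F)) : _ →* ClassGroup (𝓞 F)).ker := by
  intro X hX
  rw [MonoidHom.mem_ker] at hX ⊢
  obtain ⟨y, rfl⟩ := mk_eq_one_div hX
  rw [MonoidHom.comp_apply, exU_div, ClassGroup.mk_eq_one_iff, coe_toPrincipalIdeal]
  exact FractionalIdeal.isPrincipal_iff _ |>.mpr ⟨_, rfl⟩

theorem mk_surj_aux : Function.Surjective (ClassGroup.mk F : _ →* ClassGroup (𝓞 F)) := by
  intro c
  obtain ⟨I, rfl⟩ := ClassGroup.mk0_surjective c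
  exact ⟨FractionalIdeal.mk0 F I, ClassGroup.mk_mk0 F I⟩

noncomputable def clAct (γ : F ≃ₐ[ℚ] F) : ClassGroup (𝓞 F) →* ClassGroup (𝓞 F) :=
  (ClassGroup.mk F).liftOfSurjective mk_surj_aux
    ⟨(ClassGroup.mk F).comp (exU (γ : F →+* F)), clAct_ker γ⟩

theorem clAct_mk (γ : F ≃ₐ[ℚ] F) (X : (FractionalIdeal (𝓞 F)⁰ F)ˣ) :
    clAct γ (ClassGroup.mk F X) = ClassGroup.mk F (exU (γ : F →+* F) X) :=
  MonoidHom.liftOfRightInverse_comp_apply _ _ (Function.rightInverse_surjInv mk_surj_aux)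
    ⟨(ClassGroup.mk F).comp (exU (γ : F →+* F)), clAct_ker γ⟩ X

theorem clAct_mul (γ δ : F ≃ₐ[ℚ] F) (c : ClassGroup (𝓞 F)) :
    clAct (γ * δ) c = clAct γ (clAct δ c) := by
  obtain ⟨X, rfl⟩ := mk_surj_aux c
  rw [clAct_mk, clAct_mk, clAct_mk, exU_comp]
  rfl

theorem clAct_one (c : ClassGroup (𝓞 F)) : clAct (1 : F ≃ₐ[ℚ] F) c = c := by
  obtain ⟨X, rfl⟩ := mk_surj_aux c
  rw [clAct_mk]
  congr 1
  exact exU_id X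

theorem smul_ne_bot_aux (γ : F ≃ₐ[ℚ] F) {I : Ideal (𝓞 F)} (hI : I ≠ ⊥) : γ • I ≠ ⊥ := by
  rw [ne_eq, ← Ideal.absNorm_eq_zero_iff, absNorm_smul_aux, Ideal.absNorm_eq_zero_iff]
  exact hI

theorem clAct_mk0 (γ : F ≃ₐ[ℚ] F) (I : Ideal (𝓞 F)) (hI : I ∈ (Ideal (𝓞 F))⁰)
    (hI' : γ • I ∈ (Ideal (𝓞 F))⁰) :
    clAct γ (ClassGroup.mk0 ⟨I, hI⟩) = ClassGroup.mk0 ⟨γ • I, hI'⟩ := by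
  rw [← ClassGroup.mk_mk0 F, clAct_mk, ← ClassGroup.mk_mk0 F]
  congr 1
  apply Units.ext
  rw [exU_val, FractionalIdeal.coe_mk0, FractionalIdeal.coe_mk0, ex_ideal]
  congr 1

/-- A class fixed by a generator of a cyclic Galois group has trivial square. -/
theorem fixed_class_sq (p : ℕ) (hp : p.Prime) [IsCyclotomicExtension {p ^ 2} ℚ F]
    (g : F ≃ₐ[ℚ] F) (hgen : ∀ x, x ∈ Subgroup.zpowers g) (c : ClassGroup (𝓞 F))
    (hc : clAct g c = c) : c ^ 2 = 1 := by
  haveI : NeZero (p ^ 2) := ⟨pow_ne_zero _ hp.ne_zero⟩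
  haveI hgal : IsGalois ℚ F := IsCyclotomicExtension.isGalois {p ^ 2} ℚ F
  haveI : IsCyclic (F ≃ₐ[ℚ] F) := ⟨g, hgen⟩
  obtain ⟨⟨I, hI⟩, rfl⟩ := ClassGroup.mk0_surjective c
  have hI0 : I ≠ ⊥ := mem_nonZeroDivisors_iff_ne_zero.mp hI
  rw [clAct_mk0 g I hI (mem_nonZeroDivisors_iff_ne_zero.mpr (smul_ne_bot_aux g hI0)),
    ClassGroup.mk0_eq_mk0_iff] at hc
  obtain ⟨x, y, hx, hy, hxy⟩ := hc
  change Ideal.span {x} * (g • I) = Ideal.span {y} * I at hxy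
  have hxF : (x : F) ≠ 0 := RingOfIntegers.coe_ne_zero_iff.mpr hx
  have hyF : (y : F) ≠ 0 := RingOfIntegers.coe_ne_zero_iff.mpr hy
  have hnorm : Algebra.norm ℚ (((y : F) / x) ^ 2) = 1 := by
    have h1 := congrArg Ideal.absNorm hxy
    rw [map_mul, map_mul, absNorm_smul_aux] at h1
    have h2 : Ideal.absNorm I ≠ 0 := by rwa [ne_eq, Ideal.absNorm_eq_zero_iff]
    have h3 := mul_right_cancel₀ h2 h1
    rw [Ideal.absNorm_span_singleton, Ideal.absNorm_span_singleton] at h3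
    have h4 : (Algebra.norm ℤ x) ^ 2 = (Algebra.norm ℤ y) ^ 2 := by
      rw [← Int.natAbs_eq_iff_sq_eq]; exact h3
    have h5 : (Algebra.norm ℚ (x : F)) ^ 2 = (Algebra.norm ℚ (y : F)) ^ 2 := by
      rw [← Algebra.coe_norm_int, ← Algebra.coe_norm_int]
      exact_mod_cast h4
    have h6 : Algebra.norm ℚ (x : F) ≠ 0 := Algebra.norm_ne_zero_iff.mpr hxF
    rw [map_pow, div_eq_mul_inv, map_mul, Algebra.norm_inv, mul_pow, ← h5, inv_pow, mul_inv_cancel₀ (pow_ne_zero _ h6)]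
  obtain ⟨u, hu⟩ := groupCohomology.exists_div_of_norm_eq_one hgen hnorm
  obtain ⟨n, hn0, hnu⟩ := IsAlgebraic.exists_integral_multiple
    ((IsFractionRing.isAlgebraic_iff ℤ ℚ F).mpr (Algebra.IsAlgebraic.isAlgebraic (u : F)))
  set m : 𝓞 F := ⟨n • (u : F), hnu⟩ with hm
  have hmF : algebraMap (𝓞 F) F m = n * (u : F) := by
    change n • (u : F) = _
    rw [zsmul_eq_mul]
  have hu0 : (u : F) ≠ 0 := u.ne_zero
  have hn0' : (n : F) ≠ 0 := by exact_mod_cast hn0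
  have hm0 : m ≠ 0 := by
    rw [← RingOfIntegers.coe_ne_zero_iff, hmF]
    exact mul_ne_zero hn0' hu0
  have hgu0 : g (u : F) ≠ 0 := by simpa using hu0
  have hgm : ((g • m : 𝓞 F) : F) = g (m : F) := rfl
  have hrel : (g • m) * y ^ 2 = m * x ^ 2 := by
    apply RingOfIntegers.ext
    push_cast
    change g (algebraMap (𝓞 F) F m) * (algebraMap (𝓞 F) F y) ^ 2 = algebraMap (𝓞 F) F m * (algebraMap (𝓞 F) F x) ^ 2
    rw [hmF, map_mul, map_intCast]
    have h1 := hu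
    field_simp at h1
    linear_combination (-(n : F)) * h1
  set I' : Ideal (𝓞 F) := Ideal.span {m} * I ^ 2 with hI'
  have hsp : ∀ (γ : F ≃ₐ[ℚ] F) (z : 𝓞 F), γ • Ideal.span {z} = Ideal.span {γ • z} := by
    intro γ z
    rw [Ideal.pointwise_smul_def, Ideal.map_span, Set.image_singleton]
    rfl
  have hginv : g • I' = I' := by
    rw [hI', smul_mul', hsp, smul_pow']
    have hx0 : Ideal.span {x} ^ 2 ≠ ⊥ := pow_ne_zero _ (by
      rwa [ne_eq, Submodule.zero_eq_bot, Ideal.span_singleton_eq_bot])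
    apply mul_left_cancel₀ hx0
    calc Ideal.span {x} ^ 2 * (Ideal.span {g • m} * (g • I) ^ 2)
        = Ideal.span {g • m} * (Ideal.span {x} * (g • I)) ^ 2 := by ring
      _ = (Ideal.span {g • m} * Ideal.span {y} ^ 2) * I ^ 2 := by rw [hxy]; ring
      _ = Ideal.span {(g • m) * y ^ 2} * I ^ 2 := by
          rw [Ideal.span_singleton_pow, Ideal.span_singleton_mul_span_singleton]
      _ = (Ideal.span {m} * Ideal.span {x} ^ 2) * I ^ 2 := by
          rw [hrel, Ideal.span_singleton_pow, Ideal.span_singleton_mul_span_singleton]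
      _ = Ideal.span {x} ^ 2 * (Ideal.span {m} * I ^ 2) := by ring
  have hinv : ∀ γ : F ≃ₐ[ℚ] F, γ • I' = I' := by
    intro γ
    have h1 : g ∈ MulAction.stabilizer (F ≃ₐ[ℚ] F) I' := hginv
    have h2 := (Subgroup.zpowers_le.mpr h1) (hgen γ)
    exact h2
  have hI'0 : I' ≠ ⊥ := mul_ne_zero (by
      rwa [ne_eq, Submodule.zero_eq_bot, Ideal.span_singleton_eq_bot]) (pow_ne_zero _ hI0)
  obtain ⟨z, hz⟩ := inv_principal p hp _ I' rfl hI'0 hinv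
  have hz0 : z ≠ 0 := by
    rintro rfl
    apply hI'0
    rw [hz]; simp
  rw [← map_pow, ← map_one (ClassGroup.mk0 (R := 𝓞 F)), ClassGroup.mk0_eq_mk0_iff]
  refine ⟨m, z, hm0, hz0, ?_⟩
  change Ideal.span {m} * I ^ 2 = Ideal.span {z} * 1
  rw [mul_one, ← hz]

noncomputable def clEnd (s : F ≃ₐ[ℚ] F) : AddMonoid.End (Additive (ClassGroup (𝓞 F))) :=
  MonoidHom.toAdditive (clAct s)

theorem no_fixed_torsion (p : ℕ) (hp : p.Prime) (hpodd : Odd p) [IsCyclotomicExtension {p ^ 2} ℚ F]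
    (s d : F ≃ₐ[ℚ] F) (hsd : s * d = d * s) (hs : s ^ p = 1)
    (hgen : ∀ x, x ∈ Subgroup.zpowers (s * d)) (c : ClassGroup (𝓞 F))
    (hd : clAct d c = c) (hcp : c ^ p = 1) : c = 1 := by
  by_contra hc1
  have hpow : ∀ (j : ℕ) (x : Additive (ClassGroup (𝓞 F))),
      (clEnd s ^ j) x =
        Additive.ofMul (clAct (s ^ j) x.toMul) := by
    intro j
    induction j with
    | zero => intro x; rw [pow_zero, pow_zero, clAct_one]; rfl
    | succ j ih =>
      intro x
      rw [pow_succ' s, clAct_mul, pow_succ']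
      change (clEnd s) ((clEnd s ^ j) x) = _
      rw [ih]
      rfl
  let Q : AddSubgroup (Additive (ClassGroup (𝓞 F))) :=
    { carrier := {x | clAct d x.toMul = x.toMul}
      zero_mem' := map_one (clAct d)
      add_mem' := by
        intro a b ha hb
        change clAct d (a.toMul * b.toMul) = a.toMul * b.toMul
        rw [map_mul, ha, hb]
      neg_mem' := by
        intro a ha
        change clAct d (a.toMul)⁻¹ = (a.toMul)⁻¹
        rw [map_inv, ha] }
  obtain ⟨e, heQ, he0, hse, hep⟩ := exists_fixed_add p hp hpodd
    (clEnd s) (by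
      ext x
      rw [hpow, hs, clAct_one]; rfl) Q (by
      intro x hx
      change clAct d (clAct s x.toMul) = clAct s x.toMul
      rw [← clAct_mul, ← hsd, clAct_mul]
      exact congrArg _ hx) (Additive.ofMul c) hd (by
        rw [← ofMul_pow, hcp]; rfl) (by
        intro h; exact hc1 h)
  have hse' : clAct s e.toMul = e.toMul := hse
  have hde' : clAct d e.toMul = e.toMul := heQ
  have h2 := fixed_class_sq p hp (s * d) hgen e.toMul (by rw [clAct_mul, hde', hse'])
  have hp' : e.toMul ^ p = 1 := hep
  have hcop : Nat.Coprime 2 p := (Nat.coprime_two_left).mpr hpodd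
  have h3 := orderOf_dvd_of_pow_eq_one h2
  have h4 := orderOf_dvd_of_pow_eq_one hp'
  have h5 := Nat.dvd_gcd h3 h4
  rw [hcop.gcd_eq_one, Nat.dvd_one, orderOf_eq_one_iff] at h5
  exact he0 h5

theorem no_fixed_torsion_pow (p : ℕ) (hp : p.Prime) (hpodd : Odd p) [IsCyclotomicExtension {p ^ 2} ℚ F]
    (s d : F ≃ₐ[ℚ] F) (hsd : s * d = d * s) (hs : s ^ p = 1)
    (hgen : ∀ x, x ∈ Subgroup.zpowers (s * d)) (a : ℕ) : ∀ (c : ClassGroup (𝓞 F)),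
    clAct d c = c → c ^ (p ^ a) = 1 → c = 1 := by
  induction a with
  | zero => intro c _ h; simpa using h
  | succ a ih =>
    intro c hd hc
    apply ih c hd
    apply no_fixed_torsion p hp hpodd s d hsd hs hgen _ (by rw [map_pow, hd])
    rw [← pow_mul, ← pow_succ, hc]
end

theorem grp_aux {G : Type*} [Group G] [Fintype G] [IsCyclic G] (hcomm : ∀ a b : G, a * b = b * a)
    (p : ℕ) (hp : p.Prime) (hcard : Nat.card G = p * (p - 1)) (s : G) (hs : orderOf s = p) :
    ∃ d : G, d ^ (p - 1) = 1 ∧ (∀ x, x ∈ Subgroup.zpowers (s * d)) ∧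
      ∀ {M : Type} [CommMonoid M] (f : G → M),
        ∏ i ∈ Finset.range p, ∏ j ∈ Finset.range (p - 1), f (s ^ i * d ^ j) = ∏ g, f g := by
  classical
  have hp1 : 0 < p - 1 := Nat.sub_pos_of_lt hp.one_lt
  obtain ⟨g, hg⟩ := IsCyclic.exists_generator (α := G)
  have hog : orderOf g = p * (p - 1) := by
    rw [orderOf_eq_card_of_forall_mem_zpowers hg, hcard]
  have hod : orderOf (g ^ p) = p - 1 := by
    rw [orderOf_pow, hog, Nat.gcd_eq_right (Dvd.intro _ rfl), Nat.mul_div_cancel_left _ hp.pos]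
  have hcop : Nat.Coprime p (p - 1) := by
    rw [Nat.coprime_self_sub_right hp.one_lt.le]
    exact Nat.coprime_one_right p
  have hosd : orderOf (s * g ^ p) = p * (p - 1) := by
    rw [Commute.orderOf_mul_eq_mul_orderOf_of_coprime (hcomm _ _) (by rw [hs, hod]; exact hcop), hs, hod]
  have hgen : ∀ x, x ∈ Subgroup.zpowers (s * g ^ p) := by
    intro x
    have : Subgroup.zpowers (s * g ^ p) = ⊤ := by
      apply Subgroup.eq_top_of_card_eq
      rw [Nat.card_zpowers, hosd, hcard]
    rw [this]; trivial
  refine ⟨g ^ p, by rw [← hod, pow_orderOf_eq_one], hgen, ?_⟩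
  intro M _ f
  set d := g ^ p with hd
  have hdp : d ^ (p - 1) = 1 := by rw [← hod, pow_orderOf_eq_one]
  have hsp : s ^ p = 1 := by rw [← hs, pow_orderOf_eq_one]
  rw [← Finset.prod_product']
  have hsurj : Finset.image (fun x : ℕ × ℕ => s ^ x.1 * d ^ x.2)
      (Finset.range p ×ˢ Finset.range (p - 1)) = Finset.univ := by
    apply Finset.eq_univ_of_forall
    intro x
    obtain ⟨n, hn⟩ := (mem_powers_iff_mem_zpowers).mpr (hgen x)
    rw [Finset.mem_image]
    refine ⟨(n % p, n % (p - 1)), ?_, ?_⟩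
    · simp only [Finset.mem_product, Finset.mem_range]
      exact ⟨Nat.mod_lt _ hp.pos, Nat.mod_lt _ hp1⟩
    · change s ^ (n % p) * d ^ (n % (p - 1)) = x
      rw [← hn]
      change _ = (s * d) ^ n
      rw [Commute.mul_pow (hcomm _ _), ← pow_mod_orderOf s n, ← pow_mod_orderOf d n, hs, hod]
  have hinj : Set.InjOn (fun x : ℕ × ℕ => s ^ x.1 * d ^ x.2)
      (Finset.range p ×ˢ Finset.range (p - 1) : Finset (ℕ × ℕ)) := by
    apply Finset.injOn_of_card_image_eq
    rw [hsurj, Finset.card_univ, Finset.card_product, Finset.card_range, Finset.card_range,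
      ← Nat.card_eq_fintype_card, hcard]
  rw [← hsurj, Finset.prod_image hinj]

theorem gal_struct (p : ℕ) (hp : p.Prime) (hpodd : Odd p) (F : Type) [Field F] [NumberField F]
    [IsCyclotomicExtension {p ^ 2} ℚ F] (A : F) (hA : IsPrimitiveRoot A (p ^ 2)) :
    ∃ s d : F ≃ₐ[ℚ] F, s A = A ^ (p + 1) ∧ s * d = d * s ∧ s ^ p = 1 ∧ d ^ (p - 1) = 1 ∧
      (∀ x, x ∈ Subgroup.zpowers (s * d)) ∧
      ∀ y : F, ∏ i ∈ Finset.range p, ∏ j ∈ Finset.range (p - 1), (s ^ i * d ^ j) y =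
        algebraMap ℚ F (Algebra.norm ℚ y) := by
  haveI : NeZero (p ^ 2) := ⟨pow_ne_zero _ hp.ne_zero⟩
  haveI hgal : IsGalois ℚ F := IsCyclotomicExtension.isGalois {p ^ 2} ℚ F
  have hp2 : p ≠ 2 := by rintro rfl; exact absurd hpodd (by decide)
  set e := IsCyclotomicExtension.Rat.galEquivZMod (p ^ 2) F with he
  haveI := ZMod.isCyclic_units_of_prime_pow p hp hp2 2
  haveI : IsCyclic (F ≃ₐ[ℚ] F) := isCyclic_of_surjective e.symm e.symm.surjective
  have hcomm : ∀ a b : F ≃ₐ[ℚ] F, a * b = b * a := by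
    intro a b
    apply e.injective
    rw [map_mul, map_mul, mul_comm]
  have hcard : Nat.card (F ≃ₐ[ℚ] F) = p * (p - 1) := by
    rw [Nat.card_congr e.toEquiv, Nat.card_eq_fintype_card, ZMod.card_units_eq_totient,
      Nat.totient_prime_pow hp (by norm_num)]
    simp
  have hord : orderOf ((1 + p : ℕ) : ZMod (p ^ 2)) = p := by
    have := ZMod.orderOf_one_add_prime hp hp2 1
    simpa using this
  have hcop : Nat.Coprime (1 + p) (p ^ 2) := by
    apply Nat.Coprime.pow_right
    simp
  set u := ZMod.unitOfCoprime (1 + p) hcop with hu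
  have hou : orderOf u = p := by
    rw [← orderOf_units, hu, ZMod.coe_unitOfCoprime, hord]
  have hos : orderOf (e.symm u) = p := by
    rw [MulEquiv.orderOf_eq, hou]
  obtain ⟨d, hd, hgen, hprod⟩ := grp_aux hcomm p hp hcard (e.symm u) hos
  refine ⟨e.symm u, d, ?_, hcomm _ _, ?_, hd, hgen, ?_⟩
  · rw [IsCyclotomicExtension.Rat.galEquivZMod_apply_of_pow_eq (p ^ 2) F (e.symm u) hA.pow_eq_one,
      ← he, MulEquiv.apply_symm_apply, hu, ZMod.coe_unitOfCoprime, ZMod.val_natCast, add_comm p 1]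
    congr 1
    apply Nat.mod_eq_of_lt
    have := hp.two_le
    nlinarith
  · have := pow_orderOf_eq_one (e.symm u)
    rwa [hos] at this
  · intro y
    rw [hprod (fun g => g y), Algebra.norm_eq_prod_automorphisms]

theorem exists_norm_N (p N : ℕ) (hp : p.Prime) (hpodd : Odd p) (hN : N.Prime) (hNp : N ≠ p)
    (hmod : N ≡ 1 [MOD p ^ 2]) (F : Type) [Field F] [NumberField F]
    [IsCyclotomicExtension {p ^ 2} ℚ F] (A : F) (hA : IsPrimitiveRoot A (p ^ 2)) :
    ∃ (s : F ≃ₐ[ℚ] F) (y : F) (k : ℕ), s A = A ^ (p + 1) ∧ ¬ p ∣ k ∧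
      ∏ j ∈ Finset.range p, (s ^ j) y = (N : F) ^ k := by
  classical
  haveI : NeZero (p ^ 2) := ⟨pow_ne_zero _ hp.ne_zero⟩
  haveI : Fact N.Prime := ⟨hN⟩
  have hp1 : p - 1 ≠ 0 := (Nat.sub_pos_of_lt hp.one_lt).ne'
  obtain ⟨s, d, hsA, hsd, hsp, hdp, hgen, hprod⟩ := gal_struct p hp hpodd F A hA
  have hNm : ¬ N ∣ p ^ 2 := fun h => hNp ((Nat.prime_dvd_prime_iff_eq hN hp).mp (hN.dvd_of_dvd_pow h))
  haveI hNmax : (Ideal.span {(N : ℤ)}).IsPrime := by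
    rw [Ideal.span_singleton_prime (by exact_mod_cast hN.ne_zero)]
    exact Nat.prime_iff_prime_int.mp hN
  obtain ⟨⟨P, hP1, hP2⟩⟩ := (Ideal.span {(N : ℤ)}).nonempty_primesOver (S := 𝓞 F)
  have hPn : Ideal.absNorm P = N := by
    have h1 := Ideal.pow_inertiaDeg N P
    have h2 : (N : ZMod (p ^ 2)) = 1 := by
      have := (ZMod.natCast_eq_natCast_iff N 1 (p ^ 2)).2 hmod
      simpa using this
    rw [IsCyclotomicExtension.Rat.inertiaDeg_eq_of_not_dvd N F P hNm, h2, orderOf_one, pow_one] at h1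
    exact h1.symm
  have hP0 : P ≠ ⊥ := by
    rw [ne_eq, ← Ideal.absNorm_eq_zero_iff, hPn]
    exact hN.ne_zero
  set Q : Ideal (𝓞 F) := ∏ j ∈ Finset.range (p - 1), (d ^ j) • P with hQ
  have hQn : Ideal.absNorm Q = N ^ (p - 1) := by
    rw [hQ, map_prod]
    simp only [absNorm_smul_aux, hPn, Finset.prod_const, Finset.card_range]
  have hQ0 : Q ≠ ⊥ := by
    rw [ne_eq, ← Ideal.absNorm_eq_zero_iff, hQn]
    exact pow_ne_zero _ hN.ne_zero
  have hQd : d • Q = Q := by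
    rw [hQ, Finset.smul_prod']
    have := prod_shift (fun j => (d ^ j) • P) (p - 1) hp1 (by simp only [hdp, pow_zero])
    rw [← this]
    refine Finset.prod_congr rfl fun j _ => ?_
    rw [smul_smul, pow_succ']
  have hQm : Q ∈ (Ideal (𝓞 F))⁰ := mem_nonZeroDivisors_iff_ne_zero.mpr hQ0
  have hdc : clAct d (ClassGroup.mk0 ⟨Q, hQm⟩) = ClassGroup.mk0 ⟨Q, hQm⟩ := by
    rw [clAct_mk0 d Q hQm (by rwa [hQd])]
    congr 1
    exact Subtype.ext hQd
  obtain ⟨a, m, hm, hcardm⟩ := Nat.exists_eq_pow_mul_and_not_dvd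
    (Nat.card_pos (α := ClassGroup (𝓞 F))).ne' p hp.ne_one
  have hm1 : (ClassGroup.mk0 ⟨Q, hQm⟩ : ClassGroup (𝓞 F)) ^ m = 1 := by
    apply no_fixed_torsion_pow p hp hpodd s d hsd hsp hgen a _ (by rw [map_pow, hdc])
    rw [← pow_mul, mul_comm, ← hcardm, pow_card_eq_one']
  rw [← map_pow, ClassGroup.mk0_eq_one_iff] at hm1
  obtain ⟨y, hy⟩ := hm1.principal
  replace hy : Q ^ m = Ideal.span {y} := hy
  have hnorm : (Algebra.norm ℤ y).natAbs = N ^ ((p - 1) * m) := by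
    rw [← Ideal.absNorm_span_singleton, ← hy, map_pow, hQn, pow_mul]
  have hk : ¬ p ∣ (p - 1) * m := by
    intro h
    rcases hp.dvd_mul.mp h with h | h
    · exact absurd (Nat.le_of_dvd (Nat.pos_of_ne_zero hp1) h) (by have := hp.pos; omega)
    · exact hm h
  have hnorm2 : ∏ i ∈ Finset.range p, (s ^ i) (∏ j ∈ Finset.range (p - 1), (d ^ j) (y : F)) =
      ((Algebra.norm ℤ y : ℤ) : F) := by
    have h1 := hprod (y : F)
    rw [← Algebra.coe_norm_int] at h1
    rw [map_intCast] at h1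
    rw [← h1]
    refine Finset.prod_congr rfl fun i _ => ?_
    rw [map_prod]
    rfl
  rcases Int.natAbs_eq (Algebra.norm ℤ y) with h | h
  · refine ⟨s, ∏ j ∈ Finset.range (p - 1), (d ^ j) (y : F), (p - 1) * m, hsA, hk, ?_⟩
    rw [hnorm2, h, hnorm]
    push_cast
    rfl
  · refine ⟨s, -∏ j ∈ Finset.range (p - 1), (d ^ j) (y : F), (p - 1) * m, hsA, hk, ?_⟩
    simp only [map_neg]
    rw [Finset.prod_neg, hnorm2, h, hnorm, Finset.card_range, hpodd.neg_one_pow]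
    push_cast
    ring

theorem stmt3_final (p N : ℕ) (hp : p.Prime) (hpodd : Odd p) (hN : N.Prime) (hNp : N ≠ p)
    (hmod : N ≡ 1 [MOD p]) (L : Type) [Field L] [NumberField L]
    (ζ : L) (hζ : IsPrimitiveRoot ζ p) (α : L) (hα : α ^ p = (N : L))
    (hLgen : Algebra.adjoin ℚ {ζ, α} = (⊤ : Subalgebra ℚ L)) :
    (p - 1) / 2 ≤ pRank p (ClassGroup (𝓞 L)) := by
  haveI : NeZero p := ⟨hp.ne_zero⟩
  haveI : Fact N.Prime := ⟨hN⟩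
  let K : IntermediateField ℚ L := IntermediateField.adjoin ℚ {ζ}
  haveI hK : IsCyclotomicExtension {p} ℚ K := hζ.intermediateField_adjoin_isCyclotomicExtension ℚ
  let ζK : K := ⟨ζ, IntermediateField.mem_adjoin_simple_self ℚ ζ⟩
  have hζK : IsPrimitiveRoot ζK p :=
    IsPrimitiveRoot.of_map_of_injective (f := algebraMap K L) hζ (algebraMap K L).injective
  have hNp' : ¬ N ∣ p := fun h => hNp ((Nat.prime_dvd_prime_iff_eq hN hp).mp h)
  have htop : IntermediateField.adjoin K {α} = ⊤ := by
    rw [eq_top_iff]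
    intro x _
    have hx : x ∈ Algebra.adjoin ℚ {ζ, α} := by rw [hLgen]; trivial
    have hle : Algebra.adjoin ℚ {ζ, α} ≤
        ((IntermediateField.adjoin K {α}).restrictScalars ℚ).toSubalgebra := by
      rw [Algebra.adjoin_le_iff]
      rintro z (rfl | rfl)
      · exact (IntermediateField.adjoin K {α}).algebraMap_mem ζK
      · exact IntermediateField.mem_adjoin_simple_self K _
    exact hle hx
  have hα' : α ^ p = algebraMap K L (N : K) := by rw [hα, map_natCast]
  obtain ⟨hdeg, hgal, σ, hσα, hσp, hfix, hσgen⟩ := kummer_setup p hp ζK hζK (N : K)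
    (fun b => not_pow_cyc N p p hp K hNp' b) α hα' htop
  by_cases h2 : N ≡ 1 [MOD p ^ 2]
  · haveI : NeZero (p ^ 2) := ⟨pow_ne_zero _ hp.ne_zero⟩
    haveI : NeZero ((p ^ 2 : ℕ) : L) := NeZero.charZero
    haveI : IsCyclotomicExtension {p ^ 2} L (CyclotomicField (p ^ 2) L) :=
      CyclotomicField.isCyclotomicExtension (p ^ 2) L
    haveI : CharZero (CyclotomicField (p ^ 2) L) :=
      charZero_of_injective_algebraMap (algebraMap L (CyclotomicField (p ^ 2) L)).injective
    exact case2_field p N hp hpodd hN hNp hmod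
      (fun F _ _ _ A hA => exists_norm_N p N hp hpodd hN hNp h2 F A hA)
      hdeg σ hσp hfix ζK hζK α hα hσα hLgen (CyclotomicField (p ^ 2) L)
  · exact case1_final p N hp hpodd hN hNp hmod h2 hdeg σ hσp hfix ζK hζK α hα

/-- Let `p` be an odd prime and `N ≠ p` a prime with `N ≡ 1 (mod p)`.
Then the `p`-rank of the class group of `L = ℚ(ζ_p, N^{1/p})` is at least `(p-1)/2`. -/
theorem stmt3 (p N : ℕ) (hp : p.Prime) (hpodd : Odd p) (hN : N.Prime) (hNp : N ≠ p)
    (hmod : N ≡ 1 [MOD p])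
    (L : Type) [Field L] [NumberField L]
    (ζ : L) (hζ : IsPrimitiveRoot ζ p)
    (α : L) (hα : α ^ p = (N : L))
    (hLgen : Algebra.adjoin ℚ {ζ, α} = (⊤ : Subalgebra ℚ L)) :
    (p - 1) / 2 ≤ pRank p (ClassGroup (𝓞 L)) := by
  exact stmt3_final p N hp hpodd hN hNp hmod L ζ hζ α hα hLgen
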